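/- arXiv:2201.00367 — 5 statements merged into one kernel-verified Lean document; each statement's English description precedes it below -/
import Mathlib

section
/- Let x and y be the 8×8 matrices over 𝔽₂ with rows x: [0,1,0,0,1,0,0,0], [1,1,0,0,0,1,0,0], [0,0,0,1,0,0,0,0], [0,0,1,0,0,0,0,0], [0,1,0,0,0,1,0,0], [1,1,0,0,1,1,0,0], [0,0,0,0,0,0,0,1], [0,0,0,0,0,0,1,0]; y: [0,0,0,0,1,0,0,0], [0,0,0,1,0,0,0,0], [0,1,0,0,0,0,0,0], [0,0,1,0,0,0,0,0], [1,0,0,0,1,0,0,0], [0,0,0,0,0,0,0,1], [0,0,0,0,0,1,0,0], [0,0,0,0,0,0,1,0]. Let Q be the quadratic form on 𝔽₂⁸ given by Q(v) = v₁² + v₅² + v₁v₅ + v₂v₆ + v₃v₇ + v₄v₈, and let O(Q) be the subgroup of GL₈(𝔽₂) of elements preserving Q. Then x has order 2, y has order 3, and the subgroup generated by x and y equals the derived subgroup of O(Q), i.e., equals Ω₈⁻(2). In particular Ω₈⁻(2) is (2,3)-generated. -/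
open Matrix

/-- The group of linear automorphisms of `F⁸` preserving the form `Q`,
as a subgroup of `GL₈(F)`. -/
def orthogonalGroupOf (F : Type*) [Field F] (Q : (Fin 8 → F) → F) :
    Subgroup (GL (Fin 8) F) where
  carrier := {g | ∀ v, Q ((g : Matrix (Fin 8) (Fin 8) F).mulVec v) = Q v}
  one_mem' := by
    intro v
    simp
  mul_mem' := by
    intro a b ha hb v
    have h : ((a * b : GL (Fin 8) F) : Matrix (Fin 8) (Fin 8) F).mulVec v
        = (a : Matrix (Fin 8) (Fin 8) F).mulVec
            ((b : Matrix (Fin 8) (Fin 8) F).mulVec v) := by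
      simp [Matrix.mulVec_mulVec]
    rw [h, ha, hb]
  inv_mem' := by
    intro a ha v
    have h1 : (a : Matrix (Fin 8) (Fin 8) F).mulVec
        (((a⁻¹ : GL (Fin 8) F) : Matrix (Fin 8) (Fin 8) F).mulVec v) = v := by
      rw [Matrix.mulVec_mulVec, ← Units.val_mul, mul_inv_cancel]
      simp
    calc Q (((a⁻¹ : GL (Fin 8) F) : Matrix (Fin 8) (Fin 8) F).mulVec v)
        = Q ((a : Matrix (Fin 8) (Fin 8) F).mulVec
            (((a⁻¹ : GL (Fin 8) F) : Matrix (Fin 8) (Fin 8) F).mulVec v)) := (ha _).symm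
      _ = Q v := by rw [h1]

/-- The minus-type quadratic form on `𝔽₂⁸`:
`Q(v) = v₁² + v₅² + v₁v₅ + v₂v₆ + v₃v₇ + v₄v₈`. -/
def QMinusTwo (v : Fin 8 → ZMod 2) : ZMod 2 :=
  v 0 ^ 2 + v 4 ^ 2 + v 0 * v 4 + v 1 * v 5 + v 2 * v 6 + v 3 * v 7

/-- The order-2 generator of `Ω₈⁻(2)`. -/
def xMinusTwo : Matrix (Fin 8) (Fin 8) (ZMod 2) :=
  !![0, 1, 0, 0, 1, 0, 0, 0;
     1, 1, 0, 0, 0, 1, 0, 0;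
     0, 0, 0, 1, 0, 0, 0, 0;
     0, 0, 1, 0, 0, 0, 0, 0;
     0, 1, 0, 0, 0, 1, 0, 0;
     1, 1, 0, 0, 1, 1, 0, 0;
     0, 0, 0, 0, 0, 0, 0, 1;
     0, 0, 0, 0, 0, 0, 1, 0]

/-- The order-3 generator of `Ω₈⁻(2)`. -/
def yMinusTwo : Matrix (Fin 8) (Fin 8) (ZMod 2) :=
  !![0, 0, 0, 0, 1, 0, 0, 0;
     0, 0, 0, 1, 0, 0, 0, 0;
     0, 1, 0, 0, 0, 0, 0, 0;
     0, 0, 1, 0, 0, 0, 0, 0;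
     1, 0, 0, 0, 1, 0, 0, 0;
     0, 0, 0, 0, 0, 0, 0, 1;
     0, 0, 0, 0, 0, 1, 0, 0;
     0, 0, 0, 0, 0, 0, 1, 0]

open scoped commutatorElement

/-- The group `O₈⁻(2)`. -/
local notation "O₈" => orthogonalGroupOf (ZMod 2) QMinusTwo

/-! ### Transvections -/

/-- The coefficient vector of the linear form `v ↦ polar QMinusTwo r v`. -/
def polarRow (r : Fin 8 → ZMod 2) : Fin 8 → ZMod 2 :=
  ![r 4, r 5, r 6, r 7, r 0, r 1, r 2, r 3]

theorem polar_QMinusTwo (r v : Fin 8 → ZMod 2) :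
    QuadraticMap.polar QMinusTwo r v = polarRow r ⬝ᵥ v := by
  simp only [QuadraticMap.polar, QMinusTwo, polarRow, dotProduct, Fin.sum_univ_eight, Pi.add_apply]
  simp
  ring_nf

theorem polarRow_dotProduct_self (r : Fin 8 → ZMod 2) : polarRow r ⬝ᵥ r = 0 := by
  rw [← polar_QMinusTwo, QuadraticMap.polar, CharTwo.add_self_eq_zero, sub_sub,
    CharTwo.add_self_eq_zero]
  simp [QMinusTwo]

theorem transvectionMatrix_mul_self (r : Fin 8 → ZMod 2) :
    (1 + vecMulVec r (polarRow r)) * (1 + vecMulVec r (polarRow r)) = 1 := by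
  rw [mul_add, mul_one, add_mul, one_mul, vecMulVec_mul_vecMulVec, polarRow_dotProduct_self,
    zero_smul, vecMulVec_zero, add_zero, add_assoc, CharTwo.add_self_eq_zero, add_zero]

/-- The orthogonal transvection `v ↦ v + polar QMinusTwo r v • r`; it preserves `QMinusTwo` when
`r` is nonsingular. -/
def transvec (r : Fin 8 → ZMod 2) : GL (Fin 8) (ZMod 2) where
  val := 1 + vecMulVec r (polarRow r)
  inv := 1 + vecMulVec r (polarRow r)
  val_inv := transvectionMatrix_mul_self r
  inv_val := transvectionMatrix_mul_self r

theorem transvec_mulVec (r v : Fin 8 → ZMod 2) :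
    (transvec r).val *ᵥ v = v + QuadraticMap.polar QMinusTwo r v • r := by
  rw [polar_QMinusTwo]
  simp [transvec, add_mulVec, vecMulVec_mulVec]

theorem transvec_mul_self (r : Fin 8 → ZMod 2) : transvec r * transvec r = 1 :=
  Units.ext (transvectionMatrix_mul_self r)

theorem transvec_inv (r : Fin 8 → ZMod 2) : (transvec r)⁻¹ = transvec r :=
  inv_eq_of_mul_eq_one_left (transvec_mul_self r)

theorem mem_orthogonalGroupOf {g : GL (Fin 8) (ZMod 2)} :
    g ∈ O₈ ↔ ∀ v, QMinusTwo (g.val *ᵥ v) = QMinusTwo v :=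
  Iff.rfl

theorem QMinusTwo_add (v w : Fin 8 → ZMod 2) :
    QMinusTwo (v + w) = QMinusTwo v + QMinusTwo w + QuadraticMap.polar QMinusTwo v w := by
  rw [QuadraticMap.polar]; ring

theorem QMinusTwo_smul (c : ZMod 2) (v : Fin 8 → ZMod 2) :
    QMinusTwo (c • v) = c ^ 2 * QMinusTwo v := by
  simp only [QMinusTwo, Pi.smul_apply, smul_eq_mul]; ring

theorem transvec_mem {r : Fin 8 → ZMod 2} (hr : QMinusTwo r = 1) : transvec r ∈ O₈ := by
  intro v
  rw [transvec_mulVec, add_comm, QMinusTwo_add, QMinusTwo_smul, hr, polar_QMinusTwo (_ • r),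
    polar_QMinusTwo]
  have h : polarRow ((polarRow r ⬝ᵥ v) • r) ⬝ᵥ v = (polarRow r ⬝ᵥ v) * (polarRow r ⬝ᵥ v) := by
    simp [polarRow, dotProduct, Fin.sum_univ_eight]
    ring
  rw [h]
  linear_combination CharTwo.add_self_eq_zero ((polarRow r ⬝ᵥ v) ^ 2)

theorem GL_ext_mulVec {g h : GL (Fin 8) (ZMod 2)} (H : ∀ v, g.val *ᵥ v = h.val *ᵥ v) : g = h :=
  Units.ext (Matrix.mulVec_injective (funext H))

theorem polar_mulVec {g : GL (Fin 8) (ZMod 2)} (hg : g ∈ O₈) (v w : Fin 8 → ZMod 2) :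
    QuadraticMap.polar QMinusTwo (g.val *ᵥ v) (g.val *ᵥ w) = QuadraticMap.polar QMinusTwo v w := by
  rw [mem_orthogonalGroupOf] at hg
  simp only [QuadraticMap.polar, ← mulVec_add, hg]

theorem conj_transvec {g : GL (Fin 8) (ZMod 2)} (hg : g ∈ O₈) (r : Fin 8 → ZMod 2) :
    g * transvec r * g⁻¹ = transvec (g.val *ᵥ r) := by
  rw [mul_inv_eq_iff_eq_mul]
  refine GL_ext_mulVec fun v => ?_
  rw [Units.val_mul, Units.val_mul, ← mulVec_mulVec, ← mulVec_mulVec, transvec_mulVec,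
    transvec_mulVec, polar_mulVec hg, mulVec_add, mulVec_smul]

theorem transvec_mulVec_eq_add {r v : Fin 8 → ZMod 2} (hr : QMinusTwo r = 1)
    (hv : QMinusTwo (r + v) = QMinusTwo v) : (transvec r).val *ᵥ v = v + r := by
  rw [transvec_mulVec, QuadraticMap.polar, hv, hr, sub_right_comm, sub_self, zero_sub]
  rw [show -(1 : ZMod 2) = 1 from rfl, one_smul]

/-- Transvections along two nonsingular vectors that are not orthogonal to each other generate a
symmetric group of degree three, so their product is a commutator. -/
theorem transvec_mul_transvec_mem {r s : Fin 8 → ZMod 2} (hr : QMinusTwo r = 1)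
    (hs : QMinusTwo s = 1) (hrs : QMinusTwo (r + s) = 1) :
    transvec r * transvec s ∈ ⁅O₈, O₈⁆ := by
  have h₁ := conj_transvec (transvec_mem hr) s
  have h₂ := conj_transvec (transvec_mem hs) r
  rw [transvec_mulVec_eq_add hr (hrs.trans hs.symm)] at h₁
  rw [transvec_mulVec_eq_add hs ((add_comm s r ▸ hrs).trans hr.symm), add_comm, ← h₁] at h₂
  have h : transvec r * transvec s = ⁅transvec s, transvec r⁆ := by
    rw [commutatorElement_def, h₂, transvec_inv, mul_assoc _ (transvec r) (transvec r),
      transvec_mul_self, mul_one]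
  rw [h]
  exact Subgroup.commutator_mem_commutator (transvec_mem hs) (transvec_mem hr)

/-! ### Vectors encoded as natural numbers -/

/-- The vector whose coordinates are the lowest eight binary digits of `n`. -/
def bits (n : ℕ) : Fin 8 → ZMod 2 := fun i => if n.testBit i then 1 else 0

/-- `QMinusTwo` on encoded vectors. -/
def bitQ (n : ℕ) : Bool :=
  n.testBit 0 ^^ n.testBit 4 ^^ (n.testBit 0 && n.testBit 4) ^^ (n.testBit 1 && n.testBit 5) ^^
    (n.testBit 2 && n.testBit 6) ^^ (n.testBit 3 && n.testBit 7)

/-- The transvection along `r` on encoded vectors. The case distinction makes the kernel evaluate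
the argument before it is duplicated. -/
def bitTransvec (r : ℕ) : ℕ → ℕ
  | 0 => 0
  | n + 1 => if bitQ (r ^^^ (n + 1)) ^^ bitQ r ^^ bitQ (n + 1) then (n + 1) ^^^ r else n + 1

theorem bitTransvec_eq (r n : ℕ) :
    bitTransvec r n = if bitQ (r ^^^ n) ^^ bitQ r ^^ bitQ n then n ^^^ r else n := by
  cases n with
  | zero => simp [bitTransvec, show bitQ 0 = false from rfl]
  | succ n => rfl

/-- A product of transvections on encoded vectors. -/
def bitAct (l : List ℕ) (n : ℕ) : ℕ := l.foldr bitTransvec n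

/-- The product of the transvections along a list of encoded vectors. -/
def transvecProd (l : List ℕ) : GL (Fin 8) (ZMod 2) := (l.map fun r => transvec (bits r)).prod

theorem ite_bool_xor (a b : Bool) :
    (if (a ^^ b) then (1 : ZMod 2) else 0) = (if a then 1 else 0) + if b then 1 else 0 := by
  revert a b; decide

theorem ite_bool_and (a b : Bool) :
    (if (a && b) then (1 : ZMod 2) else 0) = (if a then 1 else 0) * if b then 1 else 0 := by
  revert a b; decide

theorem ite_bool_sq (a : Bool) :
    (if a then (1 : ZMod 2) else 0) ^ 2 = if a then 1 else 0 := by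
  revert a; decide

theorem bits_xor (m n : ℕ) : bits (m ^^^ n) = bits m + bits n := by
  funext i
  simp only [bits, Nat.testBit_xor, Pi.add_apply, ← ite_bool_xor]

theorem QMinusTwo_bits (n : ℕ) : QMinusTwo (bits n) = if bitQ n then 1 else 0 := by
  simp only [QMinusTwo, bits, ite_bool_sq, ← ite_bool_xor, ← ite_bool_and, bitQ, Bool.xor_assoc]
  rfl

theorem QMinusTwo_bits_eq_iff {m n : ℕ} : QMinusTwo (bits m) = QMinusTwo (bits n) ↔
    bitQ m = bitQ n := by
  rw [QMinusTwo_bits, QMinusTwo_bits]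
  cases bitQ m <;> cases bitQ n <;> decide

theorem QMinusTwo_bits_eq_one_iff {n : ℕ} : QMinusTwo (bits n) = 1 ↔ bitQ n := by
  rw [QMinusTwo_bits]
  cases bitQ n <;> decide

theorem exists_bits_eq (v : Fin 8 → ZMod 2) : ∃ n < 256, bits n = v := by
  refine ⟨Nat.ofBits fun i : Fin 8 => decide (v i = 1), Nat.ofBits_lt_two_pow _, ?_⟩
  funext i
  simp only [bits, Nat.testBit_ofBits_lt _ _ i.isLt, Fin.eta, decide_eq_true_eq]
  generalize v i = a
  revert a; decide

theorem transvec_bits_mulVec (r n : ℕ) :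
    (transvec (bits r)).val *ᵥ bits n = bits (bitTransvec r n) := by
  rw [transvec_mulVec, QuadraticMap.polar, ← bits_xor, QMinusTwo_bits, QMinusTwo_bits,
    QMinusTwo_bits, bitTransvec_eq, CharTwo.sub_eq_add, CharTwo.sub_eq_add, ← ite_bool_xor,
    ← ite_bool_xor, Bool.xor_assoc]
  split_ifs <;> simp [bits_xor]

theorem transvecProd_mulVec (l : List ℕ) (n : ℕ) :
    (transvecProd l).val *ᵥ bits n = bits (bitAct l n) := by
  induction l with
  | nil => simp [transvecProd, bitAct]
  | cons r l ih =>
    have h : transvecProd (r :: l) = transvec (bits r) * transvecProd l := by simp [transvecProd]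
    rw [h, Units.val_mul, ← mulVec_mulVec, ih, transvec_bits_mulVec]
    rfl

theorem transvecProd_append (l m : List ℕ) :
    transvecProd (l ++ m) = transvecProd l * transvecProd m := by
  simp [transvecProd]

theorem bits_two_pow (i : Fin 8) : bits (2 ^ (i : ℕ)) = Pi.single i 1 := by
  funext j
  simp [bits, Nat.testBit_two_pow, Pi.single_apply, Fin.ext_iff, eq_comm]

theorem matrix_ext_bits {A B : Matrix (Fin 8) (Fin 8) (ZMod 2)}
    (h : ∀ i : Fin 8, A *ᵥ bits (2 ^ (i : ℕ)) = B *ᵥ bits (2 ^ (i : ℕ))) : A = B :=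
  Matrix.ext_of_mulVec_single fun i => by rw [← bits_two_pow, h]

theorem transvecProd_congr {l m : List ℕ}
    (h : ∀ i : Fin 8, bitAct l (2 ^ (i : ℕ)) = bitAct m (2 ^ (i : ℕ))) :
    transvecProd l = transvecProd m :=
  Units.ext <| matrix_ext_bits fun i => by rw [transvecProd_mulVec, transvecProd_mulVec, h]

/-! ### Generation of the orthogonal group by transvections -/

/-- The standard basis, encoded and ordered by hyperbolic pairs, with the anisotropic plane last. -/
def basisCode (i : ℕ) : ℕ := [2, 32, 4, 64, 8, 128, 1, 16].getD i 0

/-- `w` has the same values as the `i`-th basis vector under `QMinusTwo` and under the polar form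
against the preceding basis vectors. -/
def basisLike (i w : ℕ) : Bool :=
  bitQ w == bitQ (basisCode i) &&
    (List.range i).all fun j => bitQ (w ^^^ basisCode j) == bitQ (basisCode i ^^^ basisCode j)

theorem basisLike_connected : ∀ i < 8, ∀ w < 256, basisLike i w ∧ w ≠ 0 →
    w = basisCode i ∨ bitQ (w ^^^ basisCode i) ∨
      ∃ z < 256, basisLike i z ∧ bitQ (w ^^^ z) ∧ bitQ (z ^^^ basisCode i) := by
  decide +kernel

/-- The group generated by the transvections along nonsingular vectors. -/
def transvecGroup : Subgroup (GL (Fin 8) (ZMod 2)) :=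
  Subgroup.closure {g | ∃ n, bitQ n ∧ g = transvec (bits n)}

theorem basisLike_iff {i w : ℕ} : basisLike i w ↔ bitQ w = bitQ (basisCode i) ∧
    ∀ j < i, bitQ (w ^^^ basisCode j) = bitQ (basisCode i ^^^ basisCode j) := by
  simp [basisLike]

theorem bitTransvec_xor {w z : ℕ} (hq : bitQ w = bitQ z) (h : bitQ (w ^^^ z)) :
    bitTransvec (w ^^^ z) w = z := by
  have h₁ : w ^^^ z ^^^ w = z := by rw [Nat.xor_comm w, Nat.xor_assoc, Nat.xor_self, Nat.xor_zero]
  have h₂ : w ^^^ (w ^^^ z) = z := by rw [← Nat.xor_assoc, Nat.xor_self, Nat.zero_xor]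
  rw [bitTransvec_eq, h₁, h, h₂, hq]
  cases bitQ z <;> simp

theorem transvec_fixes {i w z j : ℕ} (hw : basisLike i w) (hz : basisLike i z) (hj : j < i) :
    (transvec (bits (w ^^^ z))).val *ᵥ bits (basisCode j) = bits (basisCode j) := by
  have hw' := QMinusTwo_bits_eq_iff.2 ((basisLike_iff.1 hw).2 j hj)
  have hz' := QMinusTwo_bits_eq_iff.2 ((basisLike_iff.1 hz).2 j hj)
  have hwq := QMinusTwo_bits_eq_iff.2 (basisLike_iff.1 hw).1
  have hzq := QMinusTwo_bits_eq_iff.2 (basisLike_iff.1 hz).1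
  rw [bits_xor, bits_xor, QMinusTwo_add, QMinusTwo_add] at hw' hz'
  have h : QuadraticMap.polar QMinusTwo (bits w) (bits (basisCode j)) =
      QuadraticMap.polar QMinusTwo (bits z) (bits (basisCode j)) := by
    linear_combination hw' - hz' - hwq + hzq
  rw [polar_QMinusTwo, polar_QMinusTwo, dotProduct_comm, dotProduct_comm (polarRow _)] at h
  have h' : polarRow (bits (w ^^^ z)) = polarRow (bits w) + polarRow (bits z) := by
    rw [bits_xor]; funext k; fin_cases k <;> rfl
  rw [transvec_mulVec, polar_QMinusTwo, h', dotProduct_comm, dotProduct_add, h,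
    CharTwo.add_self_eq_zero, zero_smul, add_zero]

theorem exists_transvecGroup_map {i w : ℕ} (hi : i < 8) (hw : w < 256) (hl : basisLike i w)
    (h0 : w ≠ 0) : ∃ k ∈ transvecGroup, k.val *ᵥ bits w = bits (basisCode i) ∧
      ∀ j < i, k.val *ᵥ bits (basisCode j) = bits (basisCode j) := by
  have step {w z : ℕ} (hw : basisLike i w) (hz : basisLike i z) (h : bitQ (w ^^^ z)) :
      ∃ k ∈ transvecGroup, k.val *ᵥ bits w = bits z ∧
        ∀ j < i, k.val *ᵥ bits (basisCode j) = bits (basisCode j) := by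
    refine ⟨transvec (bits (w ^^^ z)), Subgroup.subset_closure ⟨_, h, rfl⟩, ?_,
      fun j hj => transvec_fixes hw hz hj⟩
    rw [transvec_bits_mulVec,
      bitTransvec_xor ((basisLike_iff.1 hw).1.trans (basisLike_iff.1 hz).1.symm) h]
  have hb : basisLike i (basisCode i) := basisLike_iff.2 ⟨rfl, fun _ _ => rfl⟩
  obtain rfl | h | ⟨z, -, hz, hwz, hzb⟩ := basisLike_connected i hi w hw ⟨hl, h0⟩
  · exact ⟨1, one_mem _, by simp, by simp⟩
  · exact step hl hb h
  · obtain ⟨k, hk, hkw, hkj⟩ := step hl hz hwz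
    obtain ⟨k', hk', hkw', hkj'⟩ := step hz hb hzb
    refine ⟨k' * k, mul_mem hk' hk, ?_, fun j hj => ?_⟩
    · rw [Units.val_mul, ← mulVec_mulVec, hkw, hkw']
    · rw [Units.val_mul, ← mulVec_mulVec, hkj j hj, hkj' j hj]

theorem transvecGroup_le : transvecGroup ≤ O₈ := by
  refine (Subgroup.closure_le _).2 ?_
  rintro _ ⟨n, hn, rfl⟩
  exact transvec_mem (QMinusTwo_bits_eq_one_iff.2 hn)

theorem exists_transvecGroup_mul_fixes {g : GL (Fin 8) (ZMod 2)} (hg : g ∈ O₈) :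
    ∀ i ≤ 8, ∃ k ∈ transvecGroup,
      ∀ j < i, (k * g).val *ᵥ bits (basisCode j) = bits (basisCode j) := by
  intro i
  induction i with
  | zero => exact fun _ => ⟨1, one_mem _, by simp⟩
  | succ i ih =>
    intro hi
    obtain ⟨k, hk, hfix⟩ := ih (by omega)
    have hkg : k * g ∈ O₈ := mul_mem (transvecGroup_le hk) hg
    obtain ⟨w, hw, hwg⟩ := exists_bits_eq ((k * g).val *ᵥ bits (basisCode i))
    have hl : basisLike i w := by
      rw [basisLike_iff]
      refine ⟨?_, fun j hj => ?_⟩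
      · rw [← QMinusTwo_bits_eq_iff, hwg, mem_orthogonalGroupOf.1 hkg]
      · rw [← QMinusTwo_bits_eq_iff, bits_xor, bits_xor, hwg, ← hfix j hj, ← mulVec_add,
          mem_orthogonalGroupOf.1 hkg, hfix j hj]
    have h0 : w ≠ 0 := by
      rintro rfl
      have h : (k * g).val *ᵥ bits (basisCode i) = (k * g).val *ᵥ 0 := by
        rw [← hwg, mulVec_zero]; funext j; simp [bits]
      have h' := Matrix.mulVec_injective_of_isUnit (k * g).isUnit h
      have hne : ∀ i < 8, bits (basisCode i) ≠ 0 := by decide +kernel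
      exact hne i (by omega) h'
    obtain ⟨k', hk', hkw, hkj⟩ := exists_transvecGroup_map (by omega) hw hl h0
    refine ⟨k' * k, mul_mem hk' hk, fun j hj => ?_⟩
    rw [mul_assoc, Units.val_mul, ← mulVec_mulVec]
    obtain hj | rfl := Nat.lt_succ_iff_lt_or_eq.1 hj
    · rw [hfix j hj, hkj j hj]
    · rw [← hwg, hkw]

theorem orthogonalGroupOf_le_transvecGroup : O₈ ≤ transvecGroup := by
  intro g hg
  obtain ⟨k, hk, hfix⟩ := exists_transvecGroup_mul_fixes hg 8 le_rfl
  have h : k * g = 1 := by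
    refine Units.ext <| matrix_ext_bits fun i => ?_
    have hb : ∀ i : Fin 8, ∃ j < 8, basisCode j = 2 ^ (i : ℕ) := by decide +kernel
    obtain ⟨j, hj, hji⟩ := hb i
    rw [← hji, hfix j hj, Units.val_one, one_mulVec]
  rw [eq_inv_of_mul_eq_one_right h]
  exact inv_mem hk

/-! ### The two generators -/

/-- `xMinusTwo` as a product of transvections. -/
def xCode : List ℕ := [1, 19, 13, 252, 240, 61]

/-- `yMinusTwo` as a product of transvections. -/
def yCode : List ℕ := [1, 16, 106, 198, 108, 202]

theorem transvecProd_xCode : (transvecProd xCode).val = xMinusTwo :=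
  matrix_ext_bits fun i => by
    rw [transvecProd_mulVec]
    revert i
    decide +kernel

theorem transvecProd_yCode : (transvecProd yCode).val = yMinusTwo :=
  matrix_ext_bits fun i => by
    rw [transvecProd_mulVec]
    revert i
    decide +kernel

theorem orderOf_transvecProd {p : ℕ} [Fact p.Prime] {l : List ℕ}
    (hp : ∀ i : Fin 8, bitAct (List.replicate p l).flatten (2 ^ (i : ℕ)) = 2 ^ (i : ℕ))
    (h1 : ∃ i : Fin 8, bits (bitAct l (2 ^ (i : ℕ))) ≠ bits (2 ^ (i : ℕ))) :
    orderOf (transvecProd l) = p := by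
  refine orderOf_eq_prime ?_ fun h => ?_
  · have hpow : transvecProd l ^ p = transvecProd (List.replicate p l).flatten := by
      simp [transvecProd, List.map_flatten, List.prod_flatten]
    rw [hpow]
    exact transvecProd_congr (m := []) hp
  · obtain ⟨i, hi⟩ := h1
    rw [← transvecProd_mulVec, h, Units.val_one, one_mulVec] at hi
    exact hi rfl

theorem transvecProd_mem_commutator {l : List (ℕ × ℕ)}
    (hl : ∀ p ∈ l, bitQ p.1 ∧ bitQ p.2 ∧ bitQ (p.1 ^^^ p.2)) :
    transvecProd (l.flatMap fun p => [p.1, p.2]) ∈ ⁅O₈, O₈⁆ := by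
  induction l with
  | nil => exact one_mem _
  | cons p l ih =>
    obtain ⟨h₁, h₂, h₃⟩ := hl p List.mem_cons_self
    rw [List.flatMap_cons, transvecProd_append]
    refine mul_mem ?_ (ih fun q hq => hl q (List.mem_cons_of_mem _ hq))
    have h := transvec_mul_transvec_mem (QMinusTwo_bits_eq_one_iff.2 h₁)
      (QMinusTwo_bits_eq_one_iff.2 h₂) (bits_xor _ _ ▸ QMinusTwo_bits_eq_one_iff.2 h₃)
    simpa [transvecProd] using h

/-- The group generated by the two given matrices. -/
def genGroup : Subgroup (GL (Fin 8) (ZMod 2)) :=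
  Subgroup.closure {transvecProd xCode, transvecProd yCode}

/-- The list of transvections spelled by a word in the two generators, with `true` for the
first. -/
def wordCode (w : List Bool) : List ℕ := w.flatMap fun b => if b then xCode else yCode

theorem transvecProd_wordCode_mem (w : List Bool) : transvecProd (wordCode w) ∈ genGroup := by
  induction w with
  | nil => exact one_mem _
  | cons b w ih =>
    rw [wordCode, List.flatMap_cons, transvecProd_append]
    refine mul_mem ?_ ih
    cases b
    · exact Subgroup.subset_closure (by simp)
    · exact Subgroup.subset_closure (by simp)

theorem genGroup_le_commutator : genGroup ≤ ⁅O₈, O₈⁆ := by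
  refine (Subgroup.closure_le _).2 ?_
  rintro _ (rfl | rfl)
  · exact transvecProd_mem_commutator (l := [(1, 19), (13, 252), (240, 61)]) (by decide)
  · exact transvecProd_mem_commutator (l := [(1, 16), (106, 198), (108, 202)]) (by decide)

theorem genGroup_le : genGroup ≤ O₈ :=
  genGroup_le_commutator.trans (Subgroup.commutator_le_self O₈)

/-- If the product of `x y ^ k` over the list `ks` acts like the product of the transvections in
`l`, then the latter lies in the group generated by `x` and `y`. -/
theorem transvecProd_mem_genGroup {l : List ℕ} (ks : List ℕ)
    (h : ∀ i : Fin 8, bitAct l (2 ^ (i : ℕ)) = bitAct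
      (wordCode (ks.flatMap fun k => true :: List.replicate k false)) (2 ^ (i : ℕ))) :
    transvecProd l ∈ genGroup :=
  transvecProd_congr h ▸ transvecProd_wordCode_mem _

/-- The commutator word `x y² x y`, of order 15, as a product of transvections. -/
def fifteenCode : List ℕ := [1, 3, 13, 23, 38, 126, 226, 232]

/-- The word `x y x y x y² x y`, of order 21, as a product of transvections. -/
def twentyOneCode : List ℕ := [1, 3, 5, 17, 29, 38, 103, 251]

/-- Powers of two words take the vector with code 18 to every nonsingular vector. -/
theorem nonsingular_orbit : ∀ n < 256, bitQ n → ∃ i < 15, ∃ j < 21,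
    (bitAct fifteenCode)^[i] ((bitAct twentyOneCode)^[j] 18) = n := by
  decide +kernel

theorem transvec_mul_transvec_mem_genGroup :
    transvec (bits 18) * transvec (bits 21) ∈ genGroup := by
  have h₁ : transvecProd [1, 9, 11, 25, 29, 88, 148, 175] ∈ genGroup :=
    transvecProd_mem_genGroup [1, 2, 1, 2, 1] (by decide +kernel)
  have h₂ : transvecProd [1, 22, 38, 42, 81, 187] ∈ genGroup :=
    transvecProd_mem_genGroup [2, 2, 1, 1, 1] (by decide +kernel)
  have h₃ : transvecProd [7, 23, 60, 70, 112, 208] ∈ genGroup :=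
    transvecProd_mem_genGroup [2, 2, 1, 1, 2] (by decide +kernel)
  have h₄ : transvecProd [5, 11, 30, 48, 68, 162] ∈ genGroup :=
    transvecProd_mem_genGroup [2, 2, 2, 2, 1, 2, 0] (by decide +kernel)
  have h := mul_mem (mul_mem h₁ h₂) (mul_mem h₃ h₄)
  simp only [← transvecProd_append] at h
  rw [transvecProd_congr (m := [18, 21]) (by decide +kernel)] at h
  simpa [transvecProd] using h

theorem conj_mem_genGroup {h : GL (Fin 8) (ZMod 2)} (hh : h ∈ genGroup) :
    transvec (bits 18) * h * transvec (bits 18) ∈ genGroup := by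
  have hx : transvecProd xCode ∈ genGroup := Subgroup.subset_closure (by simp)
  have hy : transvecProd yCode ∈ genGroup := Subgroup.subset_closure (by simp)
  suffices H : genGroup ≤ genGroup.comap (MulAut.conj (transvec (bits 18))).toMonoidHom by
    simpa [transvec_inv] using H hh
  refine (Subgroup.closure_le _).2 ?_
  rintro _ (rfl | rfl)
  · have h := conj_transvec (genGroup_le hx) (bits 18)
    rw [transvecProd_mulVec, show bitAct xCode 18 = 18 by decide +kernel,
      mul_inv_eq_iff_eq_mul] at h
    simpa [← h, transvec_inv, mul_assoc, transvec_mul_self] using hx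
  · have h := conj_transvec (genGroup_le hy) (bits 18)
    rw [transvecProd_mulVec, show bitAct yCode 18 = 21 by decide +kernel,
      mul_inv_eq_iff_eq_mul] at h
    have h' := mul_mem transvec_mul_transvec_mem_genGroup hy
    rw [mul_assoc, ← h] at h'
    simpa [transvec_inv, mul_assoc] using h'

theorem exists_genGroup_map {n : ℕ} (hn : bitQ n) :
    ∃ h ∈ genGroup, h.val *ᵥ bits 18 = bits n := by
  obtain ⟨m, hm, hmn⟩ := exists_bits_eq (bits n)
  have hmq : bitQ m := by rwa [← QMinusTwo_bits_eq_one_iff, hmn, QMinusTwo_bits_eq_one_iff]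
  obtain ⟨i, -, j, -, hij⟩ := nonsingular_orbit m hm hmq
  have hiter (l : List ℕ) (k a : ℕ) :
      (transvecProd l ^ k).val *ᵥ bits a = bits ((bitAct l)^[k] a) := by
    induction k with
    | zero => simp
    | succ k ih =>
      rw [pow_succ', Units.val_mul, ← mulVec_mulVec, ih, transvecProd_mulVec,
        Function.iterate_succ_apply']
  have ha : transvecProd fifteenCode ∈ genGroup :=
    transvecProd_mem_genGroup [2, 1] (by decide +kernel)
  have hb : transvecProd twentyOneCode ∈ genGroup :=
    transvecProd_mem_genGroup [1, 1, 2, 1] (by decide +kernel)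
  refine ⟨transvecProd fifteenCode ^ i * transvecProd twentyOneCode ^ j,
    mul_mem (pow_mem ha _) (pow_mem hb _), ?_⟩
  rw [Units.val_mul, ← mulVec_mulVec, hiter, hiter, hij, hmn]

theorem mem_genGroup_or {g : GL (Fin 8) (ZMod 2)} (hg : g ∈ O₈) :
    g ∈ genGroup ∨ ∃ h ∈ genGroup, g = transvec (bits 18) * h := by
  have ht := transvec_mul_self (bits 18)
  replace hg := orthogonalGroupOf_le_transvecGroup hg
  induction hg using Subgroup.closure_induction with
  | mem g hg =>
    obtain ⟨n, hn, rfl⟩ := hg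
    obtain ⟨h, hh, hhn⟩ := exists_genGroup_map hn
    refine .inr ⟨_, mul_mem (conj_mem_genGroup hh) (inv_mem hh), ?_⟩
    rw [← hhn, ← conj_transvec (genGroup_le hh)]
    simp only [← mul_assoc, ht, one_mul]
  | one => exact .inl (one_mem _)
  | mul a b _ _ ha hb =>
    obtain ha | ⟨a, ha, rfl⟩ := ha <;> obtain hb | ⟨b, hb, rfl⟩ := hb
    · exact .inl (mul_mem ha hb)
    · refine .inr ⟨_, mul_mem (conj_mem_genGroup ha) hb, ?_⟩
      simp only [← mul_assoc, ht, one_mul]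
    · exact .inr ⟨_, mul_mem ha hb, mul_assoc _ _ _⟩
    · refine .inl ?_
      simpa only [← mul_assoc] using mul_mem (conj_mem_genGroup ha) hb
  | inv a _ ha =>
    obtain ha | ⟨a, ha, rfl⟩ := ha
    · exact .inl (inv_mem ha)
    · refine .inr ⟨_, conj_mem_genGroup (inv_mem ha), ?_⟩
      simp only [_root_.mul_inv_rev, transvec_inv, ← mul_assoc, ht, one_mul]

theorem commutator_le_genGroup : ⁅O₈, O₈⁆ ≤ genGroup := by
  rw [Subgroup.commutator_le]
  intro a ha b hb
  rw [commutatorElement_def]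
  replace ha := mem_genGroup_or ha
  replace hb := mem_genGroup_or hb
  obtain ha | ⟨a, ha, rfl⟩ := ha <;> obtain hb | ⟨b, hb, rfl⟩ := hb
  · exact mul_mem (mul_mem (mul_mem ha hb) (inv_mem ha)) (inv_mem hb)
  · have h := mul_mem ha (conj_mem_genGroup (mul_mem (mul_mem hb (inv_mem ha)) (inv_mem hb)))
    simpa only [_root_.mul_inv_rev, transvec_inv, mul_assoc] using h
  · have h := mul_mem (conj_mem_genGroup (mul_mem (mul_mem ha hb) (inv_mem ha))) (inv_mem hb)
    simpa only [_root_.mul_inv_rev, transvec_inv, mul_assoc] using h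
  · have h := mul_mem (mul_mem (mul_mem (conj_mem_genGroup ha) hb) (inv_mem ha))
      (conj_mem_genGroup (inv_mem hb))
    simpa only [_root_.mul_inv_rev, transvec_inv, mul_assoc] using h

/-- The matrices `x` and `y` have orders 2 and 3 and generate `Ω₈⁻(2)`, the
derived subgroup of the orthogonal group of the minus-type quadratic form `Q`
over `𝔽₂`. In particular `Ω₈⁻(2)` is `(2,3)`-generated. -/
theorem xMinusTwo_yMinusTwo_generate_omega8minus2 :
    ∃ xu yu : GL (Fin 8) (ZMod 2),
      (xu : Matrix (Fin 8) (Fin 8) (ZMod 2)) = xMinusTwo ∧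
      (yu : Matrix (Fin 8) (Fin 8) (ZMod 2)) = yMinusTwo ∧
      orderOf xu = 2 ∧ orderOf yu = 3 ∧
      Subgroup.closure {xu, yu} =
        Subgroup.map (orthogonalGroupOf (ZMod 2) QMinusTwo).subtype
          (commutator ↥(orthogonalGroupOf (ZMod 2) QMinusTwo)) := by
  refine ⟨transvecProd xCode, transvecProd yCode, transvecProd_xCode, transvecProd_yCode,
    orderOf_transvecProd (by decide +kernel) (by decide +kernel),
    orderOf_transvecProd (by decide +kernel) (by decide +kernel), ?_⟩
  rw [Subgroup.map_subtype_commutator]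
  exact le_antisymm genGroup_le_commutator commutator_le_genGroup
end

section
/- For every integer f ≥ 1 there exists an element a of the field 𝔽_{2^f} such that the subfield of 𝔽_{2^f} generated by a is all of 𝔽_{2^f}, and the polynomial X² + X + (a+1)⁴ is irreducible in 𝔽_{2^f}[X]. -/
open Polynomial

/-- An element that does not generate a field of order `2 ^ f` lies in a subfield of order
`2 ^ d` with `1 ≤ d ≤ f / 2`. -/
lemma exists_pow_eq_self_of_closure_ne_top {F : Type*} [Field F] [Fintype F] {f : ℕ}
    (hcard : Fintype.card F = 2 ^ f) {a : F} (ha : Subfield.closure {a} ≠ ⊤) :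
    ∃ d ∈ Finset.Icc 1 (f / 2), a ^ 2 ^ d = a := by
  classical
  set K := Subfield.closure {a}
  have haK : a ∈ K := Subfield.subset_closure rfl
  have hpow : Fintype.card F = Fintype.card K ^ Module.finrank K F :=
    Module.card_eq_pow_finrank
  have hrank : 2 ≤ Module.finrank K F := by
    have hpos : 0 < Module.finrank K F := Module.finrank_pos
    by_contra! hlt
    have hone : Module.finrank K F = 1 := by omega
    rw [hone, pow_one] at hpow
    refine ha (eq_top_iff.2 fun x _ => ?_)
    have hbij : Function.Bijective (Subtype.val : K → F) :=
      (Fintype.bijective_iff_injective_and_card _).2 ⟨Subtype.val_injective, hpow.symm⟩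
    obtain ⟨y, rfl⟩ := hbij.2 x
    exact y.2
  obtain ⟨d, -, hd⟩ := (Nat.dvd_prime_pow Nat.prime_two).1
    (show Fintype.card K ∣ 2 ^ f by
      rw [← hcard, hpow]; exact dvd_pow_self _ (by omega))
  have hdf : f = d * Module.finrank K F := by
    rw [hcard, hd, ← pow_mul] at hpow
    exact Nat.pow_right_injective le_rfl hpow
  refine ⟨d, Finset.mem_Icc.2 ⟨?_, ?_⟩, ?_⟩
  · have hlt : 1 < Fintype.card K := Fintype.one_lt_card
    rw [hd] at hlt
    by_contra! h
    simp [show d = 0 by omega] at hlt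
  · rw [Nat.le_div_iff_mul_le two_pos, hdf]
    exact Nat.mul_le_mul_left d hrank
  · have h := FiniteField.pow_card (⟨a, haK⟩ : K)
    rw [hd] at h
    exact congrArg Subtype.val h

lemma card_filter_pow_eq_self_and_ne_one_le {F : Type*} [Field F] [Fintype F] [DecidableEq F]
    {q : ℕ} (hq : 1 < q) :
    (Finset.univ.filter fun a : F => a ^ q = a ∧ a ≠ 1).card ≤ q - 1 := by
  have hne : (X ^ q - X : F[X]) ≠ 0 := FiniteField.X_pow_card_sub_X_ne_zero F hq
  have hsub : (Finset.univ.filter fun a : F => a ^ q = a ∧ a ≠ 1) ⊆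
      (X ^ q - X : F[X]).roots.toFinset.erase 1 := by
    intro a ha
    obtain ⟨ha, ha'⟩ := (Finset.mem_filter.1 ha).2
    simp [hne, ha, ha']
  refine (Finset.card_le_card hsub).trans ?_
  rw [Finset.card_erase_of_mem (by simp [hne])]
  refine Nat.sub_le_sub_right ?_ 1
  calc _ ≤ (X ^ q - X : F[X]).roots.card := Multiset.toFinset_card_le _
    _ ≤ (X ^ q - X : F[X]).natDegree := card_roots' _
    _ = q := FiniteField.X_pow_card_sub_X_natDegree_eq F hq

lemma sum_Icc_two_pow_sub_one (m : ℕ) :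
    ∑ d ∈ Finset.Icc 1 m, (2 ^ d - 1) + (m + 2) = 2 ^ (m + 1) := by
  induction m with
  | zero => simp
  | succ m ih =>
    rw [Finset.sum_Icc_succ_top (by omega)]
    have : 1 ≤ 2 ^ (m + 1) := Nat.one_le_two_pow
    rw [pow_succ 2 (m + 1)]
    omega

lemma two_mul_sum_Icc_two_pow_sub_one_lt (f : ℕ) (hf : 1 ≤ f) :
    2 * ∑ d ∈ Finset.Icc 1 (f / 2), (2 ^ d - 1) < 2 ^ f := by
  have h := sum_Icc_two_pow_sub_one (f / 2)
  by_cases hf2 : f = 2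
  · subst hf2; decide
  · have hle : 2 ^ (f / 2 + 2) ≤ 2 ^ f ∨ f = 1 := by
      by_cases h1 : f = 1
      · exact .inr h1
      · exact .inl (Nat.pow_le_pow_right two_pos (by omega))
    rcases hle with hle | rfl
    · rw [pow_succ] at hle
      omega
    · decide

/-- The Artin–Schreier map `x ↦ x² + x` hits at most half of a finite field of
characteristic two. -/
lemma card_le_two_mul_card_filter_forall_sq_add_ne {F : Type*} [Field F] [Fintype F]
    [DecidableEq F] [CharP F 2] :
    Fintype.card F ≤ 2 * (Finset.univ.filter fun b : F => ∀ x : F, x ^ 2 + x ≠ b).card := by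
  have himage : 2 * (Finset.univ.image fun x : F => x ^ 2 + x).card ≤ Fintype.card F := by
    refine Finset.mul_card_image_le_card Finset.univ 2 fun b hb => ?_
    obtain ⟨x, -, rfl⟩ := Finset.mem_image.1 hb
    refine (Finset.card_pair (show x ≠ x + 1 by simp)).ge.trans
      (Finset.card_le_card fun y hy => Finset.mem_filter.2 ⟨Finset.mem_univ _, ?_⟩)
    rcases Finset.mem_insert.1 hy with rfl | hy
    · rfl
    · rw [Finset.mem_singleton.1 hy]
      linear_combination (x + 1) * CharTwo.two_eq_zero (R := F)
  have hcompl : (Finset.univ.filter fun b : F => ∀ x : F, x ^ 2 + x ≠ b) =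
      (Finset.univ.image fun x : F => x ^ 2 + x)ᶜ := by
    ext b; simp
  rw [hcompl, Finset.card_compl]
  omega

lemma irreducible_X_sq_add_X_add_C {F : Type*} [Field F] [CharP F 2] {b : F}
    (hb : ∀ x : F, x ^ 2 + x ≠ b) : Irreducible (X ^ 2 + X + C b : F[X]) := by
  have hdeg : (X ^ 2 + X + C b : F[X]).natDegree = 2 := by compute_degree!
  rw [irreducible_iff_roots_eq_zero_of_degree_le_three hdeg.ge (by omega)]
  refine Multiset.eq_zero_of_forall_notMem fun x hx => hb x ?_
  have hroot := (mem_roots'.1 hx).2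
  simpa [IsRoot.def, CharTwo.add_eq_zero] using hroot

/-- For every `f ≥ 1` and the field `𝔽_{2^f}`, there exists a generator `a` of
`𝔽_{2^f}` over `𝔽₂` such that `X² + X + (a+1)⁴` is irreducible over `𝔽_{2^f}`. -/
theorem exists_generator_with_irreducible_quadratic
    (f : ℕ) (hf : 1 ≤ f) (F : Type*) [Field F] [Fintype F]
    (hcard : Fintype.card F = 2 ^ f) :
    ∃ a : F, Subfield.closure {a} = ⊤ ∧
      Irreducible (X ^ 2 + X + C ((a + 1) ^ 4) : F[X]) := by
  classical
  have : CharP F 2 := charP_of_card_eq_prime_pow hcard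
  by_contra! hno
  have hsurj : Function.Surjective fun a : F => (a + 1) ^ 4 := by
    intro b
    obtain ⟨c, rfl⟩ := (bijective_iterateFrobenius F 2 2).2 b
    exact ⟨c - 1, by simp [iterateFrobenius_def]⟩
  have hsub : (Finset.univ.filter fun b : F => ∀ x : F, x ^ 2 + x ≠ b) ⊆
      ((Finset.Icc 1 (f / 2)).biUnion fun d =>
        Finset.univ.filter fun a : F => a ^ 2 ^ d = a ∧ a ≠ 1).image
          fun a => (a + 1) ^ 4 := by
    intro b hb
    obtain ⟨a, rfl⟩ := hsurj b
    have hb := (Finset.mem_filter.1 hb).2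
    obtain ⟨d, hd, had⟩ := exists_pow_eq_self_of_closure_ne_top hcard
      fun htop => hno a htop (irreducible_X_sq_add_X_add_C hb)
    refine Finset.mem_image_of_mem _ (Finset.mem_biUnion.2 ⟨d, hd, ?_⟩)
    refine Finset.mem_filter.2 ⟨Finset.mem_univ _, had, ?_⟩
    rintro rfl
    exact hb 0 (by simp [CharTwo.add_self_eq_zero])
  have hle := ((Finset.card_le_card hsub).trans Finset.card_image_le).trans
    (Finset.card_biUnion_le.trans (Finset.sum_le_sum fun d hd =>
      card_filter_pow_eq_self_and_ne_one_le (F := F)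
        (Nat.one_lt_two_pow (by have := (Finset.mem_Icc.1 hd).1; omega))))
  have hhalf := card_le_two_mul_card_filter_forall_sq_add_ne (F := F)
  have hlt := two_mul_sum_Icc_two_pow_sub_one_lt f hf
  omega
end

section
/- Let q = 2^f, let a ∈ 𝔽_q, and suppose the polynomial X² + X + (a+1)⁴ is irreducible over 𝔽_q. Let Q be the quadratic form on 𝔽_q⁸ defined by Q(v) = v₁² + v₅² + a²(v₂² + v₃² + v₄² + v₆² + v₇² + v₈²) + v₁v₅ + v₂v₆ + v₃v₇ + v₄v₈. Then the 3-dimensional subspace spanned by a·e₁+e₂, a·e₁+e₃, a·e₁+e₄ is totally singular for Q, but there exists no 4-dimensional subspace of 𝔽_q⁸ that is totally singular for Q. (Hence Q has Witt index 3, i.e., Q is of minus type.) -/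
open Polynomial

/-- The quadratic form
`Q(v) = v₁² + v₅² + a²(v₂²+v₃²+v₄²+v₆²+v₇²+v₈²) + v₁v₅ + v₂v₆ + v₃v₇ + v₄v₈`
on `𝔽_q⁸`, `q` even. -/
def QMinusEven {F : Type*} [Field F] (a : F) (v : Fin 8 → F) : F :=
  v 0 ^ 2 + v 4 ^ 2 +
    a ^ 2 * (v 1 ^ 2 + v 2 ^ 2 + v 3 ^ 2 + v 5 ^ 2 + v 6 ^ 2 + v 7 ^ 2) +
    v 0 * v 4 + v 1 * v 5 + v 2 * v 6 + v 3 * v 7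

/-- If `W` is totally isotropic for a nondegenerate form and every vector of `W` orthogonal to `U`
lies in `U`, then `dim W ≤ dim U`. -/
theorem LinearMap.BilinForm.finrank_le_of_inf_orthogonal_le {K V : Type*} [Field K]
    [AddCommGroup V] [Module K V] [FiniteDimensional K V] {B : LinearMap.BilinForm K V}
    (hB : B.Nondegenerate) {U W : Submodule K V} (hW : W ≤ B.orthogonal W)
    (hWU : W ⊓ B.orthogonal U ≤ U) :
    Module.finrank K W ≤ Module.finrank K U := by
  have hinf : W ⊓ B.orthogonal U ≤ W ⊓ U := le_inf inf_le_left hWU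
  have hsup : W ⊔ B.orthogonal U ≤ B.orthogonal (W ⊓ U) :=
    sup_le (hW.trans (B.orthogonal_le inf_le_left)) (B.orthogonal_le inf_le_right)
  have h₁ := Submodule.finrank_mono hinf
  have h₂ := Submodule.finrank_mono hsup
  have h₃ := Submodule.finrank_sup_add_finrank_inf_eq W (B.orthogonal U)
  rw [finrank_orthogonal hB] at h₂ h₃
  have h₄ := Submodule.finrank_le U
  have h₅ := Submodule.finrank_le (W ⊓ U)
  omega

/-- The form `t² + ts + cs²` is anisotropic when `X² + X + c` is irreducible. -/
theorem eq_zero_and_eq_zero_of_irreducible {F : Type*} [Field F] {c : F}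
    (hirr : Irreducible (X ^ 2 + X + C c : F[X])) {s t : F}
    (h : t ^ 2 + t * s + c * s ^ 2 = 0) : s = 0 ∧ t = 0 := by
  have hs : s = 0 := by
    by_contra hs
    have hdeg : (X ^ 2 + X + C c : F[X]).natDegree = 2 := by compute_degree!
    refine hirr.not_isRoot_of_natDegree_ne_one (by omega) (x := t / s) ?_
    simp only [IsRoot.def, eval_add, eval_pow, eval_X, eval_C]
    field_simp
    linear_combination h
  subst hs
  simpa using h

namespace QMinusEven

variable {F : Type*} [Field F]

/-- The polar form of `QMinusEven a` in characteristic two. -/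
def polarForm (F : Type*) [Field F] : LinearMap.BilinForm F (Fin 8 → F) :=
  LinearMap.mk₂ F
    (fun v w => v 0 * w 4 + v 4 * w 0 + v 1 * w 5 + v 5 * w 1 +
      v 2 * w 6 + v 6 * w 2 + v 3 * w 7 + v 7 * w 3)
    (by intros; simp only [Pi.add_apply]; ring)
    (by intros; simp only [Pi.smul_apply, smul_eq_mul]; ring)
    (by intros; simp only [Pi.add_apply]; ring)
    (by intros; simp only [Pi.smul_apply, smul_eq_mul]; ring)

theorem polarForm_apply (v w : Fin 8 → F) :
    polarForm F v w = v 0 * w 4 + v 4 * w 0 + v 1 * w 5 + v 5 * w 1 +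
      v 2 * w 6 + v 6 * w 2 + v 3 * w 7 + v 7 * w 3 :=
  rfl

theorem polarForm_comm (v w : Fin 8 → F) : polarForm F v w = polarForm F w v := by
  simp only [polarForm_apply]
  ring

theorem polarForm_nondegenerate : (polarForm F).Nondegenerate := by
  have hleft : (polarForm F).SeparatingLeft := by
    intro v hv
    have h (j : Fin 8) := hv (Pi.single j 1)
    ext i
    fin_cases i
    · simpa [polarForm_apply, Pi.single_apply] using h 4
    · simpa [polarForm_apply, Pi.single_apply] using h 5
    · simpa [polarForm_apply, Pi.single_apply] using h 6
    · simpa [polarForm_apply, Pi.single_apply] using h 7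
    · simpa [polarForm_apply, Pi.single_apply] using h 0
    · simpa [polarForm_apply, Pi.single_apply] using h 1
    · simpa [polarForm_apply, Pi.single_apply] using h 2
    · simpa [polarForm_apply, Pi.single_apply] using h 3
  exact ⟨hleft, fun w hw => hleft w fun v => (polarForm_comm w v).trans (hw v)⟩

theorem map_add (h2 : (2 : F) = 0) (a : F) (v w : Fin 8 → F) :
    QMinusEven a (v + w) = QMinusEven a v + QMinusEven a w + polarForm F v w := by
  simp only [QMinusEven, polarForm_apply, Pi.add_apply]
  linear_combination (v 0 * w 0 + v 4 * w 4 + a ^ 2 * (v 1 * w 1 + v 2 * w 2 + v 3 * w 3 +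
    v 5 * w 5 + v 6 * w 6 + v 7 * w 7)) * h2

theorem le_orthogonal_of_totallySingular (h2 : (2 : F) = 0) {a : F}
    {W : Submodule F (Fin 8 → F)} (hW : ∀ w ∈ W, QMinusEven a w = 0) :
    W ≤ (polarForm F).orthogonal W := by
  intro w hw v hv
  simpa [map_add h2, hW v hv, hW w hw] using hW (v + w) (W.add_mem hv hw)

/-- The subspace spanned by `a·e₁+e₂, a·e₁+e₃, a·e₁+e₄`. -/
abbrev singularSpan (a : F) : Submodule F (Fin 8 → F) :=
  Submodule.span F {![a,1,0,0,0,0,0,0], ![a,0,1,0,0,0,0,0], ![a,0,0,1,0,0,0,0]}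

theorem mem_singularSpan_iff {a : F} {v : Fin 8 → F} :
    v ∈ singularSpan a ↔
      v 0 = a * (v 1 + v 2 + v 3) ∧ v 4 = 0 ∧ v 5 = 0 ∧ v 6 = 0 ∧ v 7 = 0 := by
  rw [Submodule.mem_span_triple]
  constructor
  · rintro ⟨x, y, z, rfl⟩
    simp
    ring
  · rintro ⟨h0, h4, h5, h6, h7⟩
    refine ⟨v 1, v 2, v 3, ?_⟩
    ext i
    fin_cases i <;> simp [h0, h4, h5, h6, h7]
    ring

theorem finrank_singularSpan (a : F) : Module.finrank F (singularSpan a) = 3 := by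
  have hli : LinearIndependent F
      ![![a,1,0,0,0,0,0,0], ![a,0,1,0,0,0,0,0], ![a,0,0,1,0,0,0,0]] := by
    rw [Fintype.linearIndependent_iff]
    intro g hg i
    have h1 := congrFun hg 1
    have h2 := congrFun hg 2
    have h3 := congrFun hg 3
    simp [Fin.sum_univ_three] at h1 h2 h3
    fin_cases i <;> assumption
  have h := finrank_span_eq_card hli
  rw [Matrix.range_cons, Matrix.range_cons, Matrix.range_cons, Matrix.range_empty,
    Set.union_empty] at h
  exact h

theorem eq_zero_of_mem_singularSpan (h2 : (2 : F) = 0) {a : F} {v : Fin 8 → F}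
    (hv : v ∈ singularSpan a) : QMinusEven a v = 0 := by
  obtain ⟨h0, h4, h5, h6, h7⟩ := mem_singularSpan_iff.1 hv
  simp only [QMinusEven, h0, h4, h5, h6, h7]
  linear_combination a ^ 2 * (v 1 ^ 2 + v 2 ^ 2 + v 3 ^ 2 + v 1 * v 2 + v 1 * v 3 + v 2 * v 3) * h2

theorem mem_singularSpan_of_mem_orthogonal (h2 : (2 : F) = 0) {a : F}
    (hirr : Irreducible (X ^ 2 + X + C ((a + 1) ^ 4) : F[X])) {v : Fin 8 → F}
    (hv : v ∈ (polarForm F).orthogonal (singularSpan a)) (hQ : QMinusEven a v = 0) :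
    v ∈ singularSpan a := by
  have h5 := hv ![a,1,0,0,0,0,0,0] (Submodule.subset_span (by simp))
  have h6 := hv ![a,0,1,0,0,0,0,0] (Submodule.subset_span (by simp))
  have h7 := hv ![a,0,0,1,0,0,0,0] (Submodule.subset_span (by simp))
  simp [polarForm_apply] at h5 h6 h7
  replace h5 : v 5 = a * v 4 := by linear_combination h5 - a * v 4 * h2
  replace h6 : v 6 = a * v 4 := by linear_combination h6 - a * v 4 * h2
  replace h7 : v 7 = a * v 4 := by linear_combination h7 - a * v 4 * h2
  obtain ⟨h4, h0⟩ := eq_zero_and_eq_zero_of_irreducible hirr (s := v 4)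
    (t := v 0 + a * (v 1 + v 2 + v 3)) (by
      rw [QMinusEven, h5, h6, h7] at hQ
      linear_combination hQ + (v 0 * a * (v 1 + v 2 + v 3) +
        a ^ 2 * (v 1 * v 2 + v 1 * v 3 + v 2 * v 3) +
        v 4 ^ 2 * (2 * a ^ 3 + 3 * a ^ 2 + 2 * a - a ^ 4)) * h2)
  refine mem_singularSpan_iff.2 ⟨?_, h4, by simp [h5, h4], by simp [h6, h4], by simp [h7, h4]⟩
  linear_combination h0 - a * (v 1 + v 2 + v 3) * h2

end QMinusEven

/-- If `q = 2^f` and `X² + X + (a+1)⁴` is irreducible over `𝔽_q`, then the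
3-dimensional subspace spanned by `a·e₁+e₂, a·e₁+e₃, a·e₁+e₄` is totally
singular for `Q`, but `𝔽_q⁸` has no 4-dimensional totally singular subspace;
i.e. `Q` has Witt index 3 and is of minus type. -/
theorem QMinusEven_witt_index_three
    (f : ℕ) (F : Type*) [Field F] [Fintype F]
    (hcard : Fintype.card F = 2 ^ f) (a : F)
    (hirr : Irreducible (X ^ 2 + X + C ((a + 1) ^ 4) : F[X])) :
    Module.finrank F
      ↥(Submodule.span F
        ({![a,1,0,0,0,0,0,0], ![a,0,1,0,0,0,0,0], ![a,0,0,1,0,0,0,0]} :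
          Set (Fin 8 → F))) = 3 ∧
    (∀ w ∈ Submodule.span F
        ({![a,1,0,0,0,0,0,0], ![a,0,1,0,0,0,0,0], ![a,0,0,1,0,0,0,0]} :
          Set (Fin 8 → F)), QMinusEven a w = 0) ∧
    ¬ ∃ W : Submodule F (Fin 8 → F),
        Module.finrank F W = 4 ∧ ∀ w ∈ W, QMinusEven a w = 0 := by
  have h2 : (2 : F) = 0 := by
    have h := FiniteField.cast_card_eq_zero F
    rw [hcard] at h
    exact eq_zero_of_pow_eq_zero (by exact_mod_cast h)
  refine ⟨QMinusEven.finrank_singularSpan a,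
    fun w hw => QMinusEven.eq_zero_of_mem_singularSpan h2 hw, ?_⟩
  rintro ⟨W, hdim, hW⟩
  have hle := LinearMap.BilinForm.finrank_le_of_inf_orthogonal_le
    QMinusEven.polarForm_nondegenerate (U := QMinusEven.singularSpan a)
    (QMinusEven.le_orthogonal_of_totallySingular h2 hW)
    fun v hv => QMinusEven.mem_singularSpan_of_mem_orthogonal h2 hirr hv.2 (hW v hv.1)
  rw [hdim, QMinusEven.finrank_singularSpan] at hle
  omega
end

section
/- Let q = 2^f ≥ 4, let a ∈ 𝔽_q be such that the subfield of 𝔽_q generated by a is all of 𝔽_q (so a ≠ 0, 1), and let K be an algebraic closure of 𝔽_q. Let x = x(a) and y be the 8×8 matrices over K with rows x: [0,a⁻¹,0,0,0,0,0,0], [a,0,0,0,0,0,0,0], [0,0,a²(a+1)⁻²,(a+1)⁻²,0,0,0,0], [0,0,(a+1)⁻²,a²(a+1)⁻²,0,0,0,0], [(a+1)²,a⁻¹,0,0,0,a,0,0], [a⁻¹,(a+1)²a⁻²,0,0,a⁻¹,0,0,0], [0,0,0,0,0,0,a²(a+1)⁻²,(a+1)⁻²], [0,0,0,0,0,0,(a+1)⁻²,a²(a+1)⁻²];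 y: [0,0,0,0,1,0,0,0], [0,0,0,1,0,0,0,0], [0,1,0,0,0,0,0,0], [0,0,1,0,0,0,0,0], [1,0,0,0,1,0,0,0], [0,0,0,0,0,0,0,1], [0,0,0,0,0,1,0,0], [0,0,0,0,0,0,1,0]. Then the only K-subspaces W of K⁸ with x·W ⊆ W and y·W ⊆ W are {0} and K⁸; that is, the subgroup ⟨x, y⟩ of GL₈(K) is absolutely irreducible. -/
open Matrix

/-- The generator `x = x(a)` of order 2 for `Ω₈⁻(q)` in characteristic 2. -/
def xMinusEven (K : Type*) [Field K] (a : K) : Matrix (Fin 8) (Fin 8) K :=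
  !![0, a⁻¹, 0, 0, 0, 0, 0, 0;
     a, 0, 0, 0, 0, 0, 0, 0;
     0, 0, a^2 * ((a+1)^2)⁻¹, ((a+1)^2)⁻¹, 0, 0, 0, 0;
     0, 0, ((a+1)^2)⁻¹, a^2 * ((a+1)^2)⁻¹, 0, 0, 0, 0;
     (a+1)^2, a⁻¹, 0, 0, 0, a, 0, 0;
     a⁻¹, (a+1)^2 * (a^2)⁻¹, 0, 0, a⁻¹, 0, 0, 0;
     0, 0, 0, 0, 0, 0, a^2 * ((a+1)^2)⁻¹, ((a+1)^2)⁻¹;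
     0, 0, 0, 0, 0, 0, ((a+1)^2)⁻¹, a^2 * ((a+1)^2)⁻¹]

/-- The generator `y` of order 3 for `Ω₈⁻(q)` in characteristic 2. -/
def yMinusEven (K : Type*) [Field K] : Matrix (Fin 8) (Fin 8) K :=
  !![0, 0, 0, 0, 1, 0, 0, 0;
     0, 0, 0, 1, 0, 0, 0, 0;
     0, 1, 0, 0, 0, 0, 0, 0;
     0, 0, 1, 0, 0, 0, 0, 0;
     1, 0, 0, 0, 1, 0, 0, 0;
     0, 0, 0, 0, 0, 0, 0, 1;
     0, 0, 0, 0, 0, 1, 0, 0;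
     0, 0, 0, 0, 0, 0, 1, 0]

section MinusEven

variable {K : Type*} [Field K]

theorem xMinusEven_mulVec (a : K) (w : Fin 8 → K) :
    (xMinusEven K a).mulVec w =
      ![a⁻¹ * w 1, a * w 0,
        a ^ 2 * ((a + 1) ^ 2)⁻¹ * w 2 + ((a + 1) ^ 2)⁻¹ * w 3,
        ((a + 1) ^ 2)⁻¹ * w 2 + a ^ 2 * ((a + 1) ^ 2)⁻¹ * w 3,
        (a + 1) ^ 2 * w 0 + a⁻¹ * w 1 + a * w 5,
        a⁻¹ * w 0 + (a + 1) ^ 2 * (a ^ 2)⁻¹ * w 1 + a⁻¹ * w 4,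
        a ^ 2 * ((a + 1) ^ 2)⁻¹ * w 6 + ((a + 1) ^ 2)⁻¹ * w 7,
        ((a + 1) ^ 2)⁻¹ * w 6 + a ^ 2 * ((a + 1) ^ 2)⁻¹ * w 7] := by
  ext i
  fin_cases i <;> simp [xMinusEven, mulVec, dotProduct, Fin.sum_univ_eight]

theorem yMinusEven_mulVec (w : Fin 8 → K) :
    (yMinusEven K).mulVec w = ![w 4, w 3, w 1, w 2, w 0 + w 4, w 7, w 5, w 6] := by
  ext i
  fin_cases i <;> simp [yMinusEven, mulVec, dotProduct, Fin.sum_univ_eight]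

variable {a : K} {W : Submodule K (Fin 8 → K)}

/-- An invariant subspace containing `e₆ + e₇ + e₈` is the whole space. -/
theorem eq_top_of_mem_of_invariant (h2 : (2 : K) = 0) (ha0 : a ≠ 0) (ha1 : a + 1 ≠ 0)
    (hxW : ∀ w ∈ W, (xMinusEven K a).mulVec w ∈ W)
    (hyW : ∀ w ∈ W, (yMinusEven K).mulVec w ∈ W)
    (hv : ![0, 0, 0, 0, 0, 1, 1, 1] ∈ W) : W = ⊤ := by
  obtain ⟨t, ht⟩ : ∃ t, t = ((a + 1) ^ 2)⁻¹ := ⟨_, rfl⟩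
  have ht' : t * (a + 1) ^ 2 = 1 := by rw [ht]; field_simp
  have p0 : ![0, 0, 0, 0, a, 1, 0, 0] ∈ W := by
    convert W.add_mem (hxW _ hv) hv using 1
    rw [xMinusEven_mulVec, ← ht]
    ext i; fin_cases i <;> simp <;> grind
  have p1 : ![a, 0, 0, 0, a, 0, 1, 0] ∈ W := by
    convert hyW _ p0 using 1
    rw [yMinusEven_mulVec]
    ext i; fin_cases i <;> simp
  have p2 : ![a, 0, 0, 0, 0, 0, 0, 1] ∈ W := by
    convert hyW _ p1 using 1
    rw [yMinusEven_mulVec]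
    ext i; fin_cases i <;> simp
    grind
  have q0 : ![0, a ^ 2, 0, 0, a * (a + 1) ^ 2, 1, t, a ^ 2 * t] ∈ W := by
    convert hxW _ p2 using 1
    rw [xMinusEven_mulVec, ← ht]
    ext i; fin_cases i <;> simp <;> grind
  have q1 : ![a * (a + 1) ^ 2, 0, a ^ 2, 0, a * (a + 1) ^ 2, a ^ 2 * t, 1, t] ∈ W := by
    convert hyW _ q0 using 1
    rw [yMinusEven_mulVec]
    ext i; fin_cases i <;> simp
  have q2 : ![a * (a + 1) ^ 2, 0, 0, a ^ 2, 0, t, a ^ 2 * t, 1] ∈ W := by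
    convert hyW _ q1 using 1
    rw [yMinusEven_mulVec]
    ext i; fin_cases i <;> simp
    grind
  have e0 : ![1, 0, 0, 0, 0, 0, 0, 0] ∈ W := by
    have hr := W.smul_mem (a⁻¹ * (a + 1) ^ 2) <|
      W.add_mem (hxW _ q1) <| W.add_mem (W.smul_mem (a ^ 2 * t) q1) <|
      W.add_mem (W.smul_mem t q2) <| W.add_mem (W.smul_mem ((a + 1) ^ 2) q0) <|
      W.add_mem (W.smul_mem (a ^ 2) p0) <|
      W.add_mem (W.smul_mem (a ^ 2 * t) p1) (W.smul_mem (a ^ 2) p2)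
    convert hr using 1
    rw [xMinusEven_mulVec, ← ht]
    ext i; fin_cases i <;> simp <;> grind
  have e4 : ![0, 0, 0, 0, 1, 0, 0, 0] ∈ W := by
    convert W.add_mem (hyW _ (hyW _ e0)) e0 using 1
    simp only [yMinusEven_mulVec]
    ext i; fin_cases i <;> simp
    grind
  have e5 : ![0, 0, 0, 0, 0, 1, 0, 0] ∈ W := by
    convert W.sub_mem p0 (W.smul_mem a e4) using 1
    ext i; fin_cases i <;> simp
  have e6 : ![0, 0, 0, 0, 0, 0, 1, 0] ∈ W := by
    convert hyW _ e5 using 1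
    rw [yMinusEven_mulVec]
    ext i; fin_cases i <;> simp
  have e7 : ![0, 0, 0, 0, 0, 0, 0, 1] ∈ W := by
    convert hyW _ e6 using 1
    rw [yMinusEven_mulVec]
    ext i; fin_cases i <;> simp
  have e1 : ![0, 1, 0, 0, 0, 0, 0, 0] ∈ W := by
    convert W.smul_mem a⁻¹ (W.sub_mem (W.sub_mem (hxW _ e0) (W.smul_mem ((a + 1) ^ 2) e4))
      (W.smul_mem a⁻¹ e5)) using 1
    rw [xMinusEven_mulVec]
    ext i; fin_cases i <;> simp [ha0]
  have e2 : ![0, 0, 1, 0, 0, 0, 0, 0] ∈ W := by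
    convert hyW _ e1 using 1
    rw [yMinusEven_mulVec]
    ext i; fin_cases i <;> simp
  have e3 : ![0, 0, 0, 1, 0, 0, 0, 0] ∈ W := by
    convert hyW _ e2 using 1
    rw [yMinusEven_mulVec]
    ext i; fin_cases i <;> simp
  refine eq_top_iff.2 fun w _ => ?_
  convert W.add_mem (W.smul_mem (w 0) e0) <| W.add_mem (W.smul_mem (w 1) e1) <|
    W.add_mem (W.smul_mem (w 2) e2) <| W.add_mem (W.smul_mem (w 3) e3) <|
    W.add_mem (W.smul_mem (w 4) e4) <| W.add_mem (W.smul_mem (w 5) e5) <|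
    W.add_mem (W.smul_mem (w 6) e6) (W.smul_mem (w 7) e7) using 1
  ext i; fin_cases i <;> simp

/-- An invariant subspace on which the functional `w₂ + w₃ + w₄` vanishes is zero. -/
theorem eq_bot_of_sum_eq_zero_of_invariant (h2 : (2 : K) = 0) (ha0 : a ≠ 0) (ha1 : a + 1 ≠ 0)
    (hxW : ∀ w ∈ W, (xMinusEven K a).mulVec w ∈ W)
    (hyW : ∀ w ∈ W, (yMinusEven K).mulVec w ∈ W)
    (hα : ∀ w ∈ W, w 1 + w 2 + w 3 = 0) : W = ⊥ := by
  obtain ⟨t, ht⟩ : ∃ t, t = ((a + 1) ^ 2)⁻¹ := ⟨_, rfl⟩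
  have ht' : t * (a + 1) ^ 2 = 1 := by rw [ht]; field_simp
  have h1 : ∀ w ∈ W, w 1 = a * w 0 := fun w hw => by
    have h := hα w hw
    have h' := hα _ (hxW w hw)
    rw [xMinusEven_mulVec, ← ht] at h'
    simp at h'
    grind
  have h3 : ∀ w ∈ W, w 3 = a * w 4 := fun w hw => by
    simpa [yMinusEven_mulVec] using h1 _ (hyW w hw)
  have h2' : ∀ w ∈ W, w 2 = a * (w 0 + w 4) := fun w hw => by
    simpa [yMinusEven_mulVec] using h3 _ (hyW w hw)
  have h5 : ∀ w ∈ W, a * w 5 = (a ^ 2 + t) * w 0 + w 4 := fun w hw => by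
    have h := h3 _ (hxW w hw)
    rw [xMinusEven_mulVec, ← ht] at h
    simp [h1 w hw, h2' w hw, h3 w hw, ha0] at h
    grind
  have h7 : ∀ w ∈ W, a * w 7 = (a ^ 2 + t) * w 4 + (w 0 + w 4) := fun w hw => by
    simpa [yMinusEven_mulVec] using h5 _ (hyW w hw)
  have h6 : ∀ w ∈ W, a * w 6 = (a ^ 2 + t) * (w 0 + w 4) + (w 4 + (w 0 + w 4)) := fun w hw => by
    simpa [yMinusEven_mulVec] using h7 _ (hyW w hw)
  have h04 : ∀ w ∈ W, w 0 + w 4 = 0 := fun w hw => by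
    have h := h7 _ (hxW w hw)
    rw [xMinusEven_mulVec, ← ht] at h
    simp [h1 w hw, ha0] at h
    have := h5 w hw
    have := h6 w hw
    have := h7 w hw
    have hzero : t * (w 0 + w 4) = 0 := by
      clear ht hα h1 h2' h3 h5 h6 h7 hxW hyW
      grind
    exact (mul_eq_zero.1 hzero).resolve_left (left_ne_zero_of_mul_eq_one ht')
  have h4 : ∀ w ∈ W, w 4 = 0 := fun w hw => by
    have h := h04 _ (hyW w hw)
    simp only [yMinusEven_mulVec] at h
    simpa [h04 w hw] using h
  have h0 : ∀ w ∈ W, w 0 = 0 := fun w hw => by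
    simpa [h4 w hw] using h04 w hw
  refine (Submodule.eq_bot_iff _).2 fun w hw => ?_
  have := h0 w hw
  have := h4 w hw
  have := h1 w hw
  have := h2' w hw
  have := h3 w hw
  have := h5 w hw
  have := h6 w hw
  have := h7 w hw
  clear hα h0 h1 h2' h3 h4 h04 h5 h6 h7 hxW hyW
  ext i; fin_cases i <;> simp <;> grind

/-- With `p = 1 + y + y²`, the element `p x p` maps `w` to a nonzero multiple of
`(w₂ + w₃ + w₄) (e₆ + e₇ + e₈)`. -/
theorem mem_of_sum_ne_zero_of_invariant (h2 : (2 : K) = 0) (ha0 : a ≠ 0) (ha1 : a + 1 ≠ 0)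
    (hxW : ∀ w ∈ W, (xMinusEven K a).mulVec w ∈ W)
    (hyW : ∀ w ∈ W, (yMinusEven K).mulVec w ∈ W)
    {w : Fin 8 → K} (hw : w ∈ W) (hne : w 1 + w 2 + w 3 ≠ 0) :
    ![0, 0, 0, 0, 0, 1, 1, 1] ∈ W := by
  obtain ⟨t, ht⟩ : ∃ t, t = ((a + 1) ^ 2)⁻¹ := ⟨_, rfl⟩
  have ht' : t * (a + 1) ^ 2 = 1 := by rw [ht]; field_simp
  have hp : ∀ w ∈ W, ![0, w 1 + w 2 + w 3, w 1 + w 2 + w 3, w 1 + w 2 + w 3, 0,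
      w 5 + w 6 + w 7, w 5 + w 6 + w 7, w 5 + w 6 + w 7] ∈ W := fun w hw => by
    convert W.add_mem (W.add_mem hw (hyW _ hw)) (hyW _ (hyW _ hw)) using 1
    simp only [yMinusEven_mulVec]
    ext i; fin_cases i <;> simp [-add_cons, -cons_add] <;> grind
  have hr := hp _ (hxW _ (hp w hw))
  convert W.smul_mem ((w 1 + w 2 + w 3)⁻¹ * t * a ^ 2) hr using 1
  generalize w 1 + w 2 + w 3 = c at *
  rw [xMinusEven_mulVec, ← ht]
  ext i; fin_cases i <;> simp <;> grind

end MinusEven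

/-- A generator of a field with at least four elements of characteristic 2 is not in the
prime field. -/
theorem ne_zero_and_add_one_ne_zero_of_closure_eq_top {F : Type*} [Field F] [Fintype F]
    [CharP F 2] (hq : 4 ≤ Fintype.card F) {a : F} (ha : Subfield.closure {a} = ⊤) :
    a ≠ 0 ∧ a + 1 ≠ 0 := by
  have key : a ∉ (ZMod.castHom (dvd_refl 2) F).fieldRange := fun hmem => by
    have htop : (ZMod.castHom (dvd_refl 2) F).fieldRange = ⊤ :=
      top_le_iff.1 (ha ▸ Subfield.closure_le.2 (Set.singleton_subset_iff.2 hmem))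
    have hle := Fintype.card_le_of_surjective _ (RingHom.fieldRange_eq_top_iff.1 htop)
    rw [ZMod.card] at hle
    omega
  refine ⟨fun h => key (h ▸ zero_mem _), fun h => key ?_⟩
  rw [eq_neg_of_add_eq_zero_left h]
  exact neg_mem (one_mem _)

/-- For `q = 2^f ≥ 4` and `a` a generator of `𝔽_q`, `⟨x(a), y⟩` is absolutely
irreducible: the only subspaces of `K⁸` (`K` an algebraic closure of `𝔽_q`)
invariant under both `x(a)` and `y` are `{0}` and `K⁸`. -/
theorem xMinusEven_yMinusEven_absolutely_irreducible
    (f : ℕ) (F : Type*) [Field F] [Fintype F]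
    (hcard : Fintype.card F = 2 ^ f) (hq : 4 ≤ Fintype.card F)
    (a : F) (ha : Subfield.closure {a} = ⊤)
    (K : Type*) [Field K] [Algebra F K] [IsAlgClosure F K]
    (W : Submodule K (Fin 8 → K))
    (hxW : ∀ w ∈ W, (xMinusEven K (algebraMap F K a)).mulVec w ∈ W)
    (hyW : ∀ w ∈ W, (yMinusEven K).mulVec w ∈ W) :
    W = ⊥ ∨ W = ⊤ := by
  have : CharP F 2 := by
    obtain ⟨p, hp⟩ := CharP.exists F
    obtain ⟨n, hprime, hn⟩ := FiniteField.card F p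
    have hdvd : p ∣ 2 ^ f := hcard ▸ hn ▸ dvd_pow_self p n.ne_zero
    rwa [(Nat.prime_dvd_prime_iff_eq hprime Nat.prime_two).1 (hprime.dvd_of_dvd_pow hdvd)] at hp
  obtain ⟨h0, h1⟩ := ne_zero_and_add_one_ne_zero_of_closure_eq_top hq ha
  have h2 : (2 : K) = 0 := by
    rw [← map_ofNat (algebraMap F K), CharTwo.two_eq_zero, map_zero]
  have h0' : algebraMap F K a ≠ 0 := by simpa using h0
  have h1' : algebraMap F K a + 1 ≠ 0 := by
    rwa [← map_one (algebraMap F K), ← map_add, Ne, map_eq_zero]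
  by_cases hα : ∀ w ∈ W, w 1 + w 2 + w 3 = 0
  · exact .inl (eq_bot_of_sum_eq_zero_of_invariant h2 h0' h1' hxW hyW hα)
  · push Not at hα
    obtain ⟨w, hw, hne⟩ := hα
    exact .inr (eq_top_of_mem_of_invariant h2 h0' h1' hxW hyW
      (mem_of_sum_ne_zero_of_invariant h2 h0' h1' hxW hyW hw hne))
end

section
/- Let p be an odd prime, q = p^f, let ξ ∈ 𝔽_q* be a nonsquare, let a ∈ 𝔽_q*, and let K be an algebraic closure of 𝔽_q. Let x = x(a,ξ) and y be the 8×8 matrices over K with rows x: [0,0,0,0,2,0,0,0], [0,1,0,0,0,0,0,0], [0,0,−1,0,0,0,−a²ξ/2,−aξ], [0,1,0,−1,0,0,0,0], [1/2,0,0,0,0,0,0,0], [0,−1/2,0,1,0,1,0,0], [0,0,0,0,0,0,−1,0], [0,0,0,0,0,0,a,1]; y: [0,0,1,0,0,0,0,0], [1,0,0,0,0,0,0,0], [0,1,0,0,0,0,0,0], [0,0,0,1,0,0,0,0], [0,0,0,0,0,0,1,0], [0,0,0,0,1,0,0,0], [0,0,0,0,0,1,0,0], [0,0,0,0,0,0,0,1].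 Then the only K-subspaces W of K⁸ with x·W ⊆ W and y·W ⊆ W are {0} and K⁸; that is, the subgroup ⟨x, y⟩ of GL₈(K) is absolutely irreducible. -/
open Matrix

/-- The generator `x = x(a,ξ)` of order 2 for `Ω₈⁻(q)` in odd characteristic. -/
def xMinusOdd (K : Type*) [Field K] (a ξ : K) : Matrix (Fin 8) (Fin 8) K :=
  !![0, 0, 0, 0, 2, 0, 0, 0;
     0, 1, 0, 0, 0, 0, 0, 0;
     0, 0, -1, 0, 0, 0, -(a^2 * ξ) / 2, -(a * ξ);
     0, 1, 0, -1, 0, 0, 0, 0;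
     1/2, 0, 0, 0, 0, 0, 0, 0;
     0, -(1/2), 0, 1, 0, 1, 0, 0;
     0, 0, 0, 0, 0, 0, -1, 0;
     0, 0, 0, 0, 0, 0, a, 1]

/-- The generator `y` of order 3 for `Ω₈⁻(q)` in odd characteristic. -/
def yMinusOdd (K : Type*) [Field K] : Matrix (Fin 8) (Fin 8) K :=
  !![0, 0, 1, 0, 0, 0, 0, 0;
     1, 0, 0, 0, 0, 0, 0, 0;
     0, 1, 0, 0, 0, 0, 0, 0;
     0, 0, 0, 1, 0, 0, 0, 0;
     0, 0, 0, 0, 0, 0, 1, 0;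
     0, 0, 0, 0, 1, 0, 0, 0;
     0, 0, 0, 0, 0, 1, 0, 0;
     0, 0, 0, 0, 0, 0, 0, 1]


/-- One half of the Norton irreducibility criterion: an endomorphism preserving `W` either has a
nonzero kernel vector in `W`, or every functional vanishing on its range vanishes on `W`. -/
theorem exists_mem_apply_eq_zero_or_forall_functional_eq_zero
    {K V : Type*} [Field K] [AddCommGroup V] [Module K V] [FiniteDimensional K V]
    (T : V →ₗ[K] V) (φ : V →ₗ[K] K) (hφ : ∀ v, φ (T v) = 0)
    (W : Submodule K V) (hT : ∀ w ∈ W, T w ∈ W) :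
    (∃ w ∈ W, w ≠ 0 ∧ T w = 0) ∨ ∀ w ∈ W, φ w = 0 := by
  by_cases hinj : Function.Injective (T.restrict hT)
  · right
    intro w hw
    obtain ⟨w', hw'⟩ := LinearMap.injective_iff_surjective.mp hinj ⟨w, hw⟩
    have hTw : T w' = w := congrArg Subtype.val hw'
    rw [← hTw, hφ]
  · left
    rw [← LinearMap.ker_eq_bot, Submodule.eq_bot_iff] at hinj
    push Not at hinj
    obtain ⟨w, hw, hne⟩ := hinj
    exact ⟨w, w.2, fun h => hne (Subtype.ext h), congrArg Subtype.val (LinearMap.mem_ker.mp hw)⟩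

/-- A vector of length eight is the list of its entries. -/
theorem vec_eight_eta {K : Type*} (w : Fin 8 → K) :
    ![w 0, w 1, w 2, w 3, w 4, w 5, w 6, w 7] = w := by
  ext i
  fin_cases i <;> rfl

/-- The involution `x(a,ξ)` in the rescaled basis
`e₁, e₂, e₃, e₄, e₅/2, e₆/2, e₇/2, a e₈/2`, where it depends only on `β = a²ξ/4`. -/
def scaledX {K : Type*} [Field K] (β : K) (w : Fin 8 → K) : Fin 8 → K :=
  ![w 4, w 1, -w 2 - β * w 6 - 2 * β * w 7, w 1 - w 3, w 0, -w 1 + 2 * w 3 + w 5, -w 6, w 6 + w 7]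

/-- The action of `y`, which is the same in the rescaled basis. -/
def scaledY {K : Type*} (w : Fin 8 → K) : Fin 8 → K :=
  ![w 2, w 0, w 1, w 3, w 6, w 4, w 5, w 7]

/-- The algebra element `x - 2y²xy² + yxy²x` in the rescaled basis. Its kernel is spanned by `e₂`
when `β ≠ 0, 1`. -/
def nortonMatrix {K : Type*} [Field K] (β : K) : Matrix (Fin 8) (Fin 8) K :=
  !![-β, 0, -2, 0, 0, 0, -2 * β, -2 * β;
     2, 0, 0, 2, 2 * β, 1, 0, 4 * β;
     0, 0, -2, 0, 0, -2, -2 * β, -4 * β;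
     0, 0, -3, 2, 0, 0, -β, -2 * β;
     0, 0, 2, -4, 0, 0, -2, 0;
     0, 0, 0, 2, 2, 1, 0, 0;
     0, 0, 1, -2, 0, 0, β - 2, 2 * β;
     1, 0, 0, 0, -2, 0, 2, 0]

/-- A row vector spanning the left kernel of `nortonMatrix`. -/
def nortonRow {K : Type*} [Field K] (β : K) : Fin 8 → K :=
  ![0, -2, β + 1, 0, -2, 2 * β + 4, 2 * β + 6, 4]

section ScaledAction

variable {K : Type*} [Field K] {β : K}

theorem nortonMatrix_mulVec (w : Fin 8 → K) :
    nortonMatrix β *ᵥ w =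
      scaledX β w - (2 : K) • scaledY (scaledY (scaledX β (scaledY (scaledY w))))
        + scaledY (scaledX β (scaledY (scaledY (scaledX β w)))) := by
  ext i
  fin_cases i <;>
    simp [nortonMatrix, scaledX, scaledY, mulVec, dotProduct, Fin.sum_univ_succ] <;> ring

theorem nortonRow_dotProduct_nortonMatrix_mulVec (w : Fin 8 → K) :
    nortonRow β ⬝ᵥ (nortonMatrix β *ᵥ w) = 0 := by
  simp [nortonMatrix, nortonRow, mulVec, dotProduct, Fin.sum_univ_succ]
  ring

theorem eq_smul_single_of_nortonMatrix_mulVec_eq_zero (h2 : (2 : K) ≠ 0) (hβ0 : β ≠ 0)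
    (hβ1 : β ≠ 1) (w : Fin 8 → K) (hw : nortonMatrix β *ᵥ w = 0) :
    w = w 1 • Pi.single 1 1 := by
  have entry (i : Fin 8) : (nortonMatrix β *ᵥ w) i = 0 := congrFun hw i
  have r0 := entry 0
  have r2 := entry 2
  have r3 := entry 3
  have r4 := entry 4
  have r5 := entry 5
  have r6 := entry 6
  have r7 := entry 7
  simp [nortonMatrix, mulVec, dotProduct, Fin.sum_univ_succ] at r0 r2 r3 r4 r5 r6 r7
  have h4 : w 2 - 2 * w 3 - w 6 = 0 := by
    apply (mul_eq_zero_iff_left h2).mp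
    linear_combination r4
  have h2' : w 2 = -w 6 := by
    apply mul_left_cancel₀ h2
    linear_combination -r3 - r6
  have h3 : w 3 = -w 6 := by
    apply mul_left_cancel₀ h2
    linear_combination h2' - h4
  have h67 : (β - 1) * w 6 + 2 * β * w 7 = 0 := by
    linear_combination r6 - h4
  have h5 : w 5 = 0 := by
    apply (mul_eq_zero_iff_left h2).mp
    linear_combination -r2 - 2 * h67 - 2 * h2'
  have h4' : w 4 = w 6 := by
    apply mul_left_cancel₀ h2
    linear_combination r5 - 2 * h3 - h5
  have h0 : w 0 = 0 := by
    linear_combination r7 + 2 * h4'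
  have h6 : w 6 = 0 := by
    apply (mul_eq_zero_iff_left (sub_ne_zero.mpr hβ1)).mp
    linear_combination -r0 - 2 * h2' - h67 - β * h0
  have h7 : w 7 = 0 := by
    apply (mul_eq_zero_iff_left (mul_ne_zero h2 hβ0)).mp
    linear_combination h67 - (β - 1) * h6
  rw [h6, neg_zero] at h2' h3
  rw [h6] at h4'
  ext i
  fin_cases i <;> simp [*]

variable {W : Submodule K (Fin 8 → K)}

theorem eq_top_of_single_mem (hx : ∀ w ∈ W, scaledX β w ∈ W) (hy : ∀ w ∈ W, scaledY w ∈ W)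
    (he : Pi.single 1 1 ∈ W) : W = ⊤ := by
  have e1 : ![0, 1, 0, 0, 0, 0, 0, 0] ∈ W := by
    convert he using 1
    ext i
    fin_cases i <;> rfl
  have e2 : ![0, 0, 1, 0, 0, 0, 0, 0] ∈ W := by simpa [scaledY] using hy _ e1
  have e0 : ![1, 0, 0, 0, 0, 0, 0, 0] ∈ W := by simpa [scaledY] using hy _ e2
  have e4 : ![0, 0, 0, 0, 1, 0, 0, 0] ∈ W := by simpa [scaledX] using hx _ e0
  have e5 : ![0, 0, 0, 0, 0, 1, 0, 0] ∈ W := by simpa [scaledY] using hy _ e4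
  have e6 : ![0, 0, 0, 0, 0, 0, 1, 0] ∈ W := by simpa [scaledY] using hy _ e5
  have e3 : ![0, 0, 0, 1, 0, 0, 0, 0] ∈ W := by
    simpa [scaledX] using W.add_mem (W.sub_mem (hx _ e1) e1) e5
  have e7 : ![0, 0, 0, 0, 0, 0, 0, 1] ∈ W := by
    simpa [scaledX] using W.add_mem (W.add_mem (hx _ e6) e6) (W.smul_mem β e2)
  rw [eq_top_iff]
  intro w _
  have := W.add_mem (W.add_mem (W.add_mem (W.smul_mem (w 0) e0) (W.smul_mem (w 1) e1))
      (W.add_mem (W.smul_mem (w 2) e2) (W.smul_mem (w 3) e3)))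
    (W.add_mem (W.add_mem (W.smul_mem (w 4) e4) (W.smul_mem (w 5) e5))
      (W.add_mem (W.smul_mem (w 6) e6) (W.smul_mem (w 7) e7)))
  rw [← vec_eight_eta w]
  simpa using this

theorem eq_bot_of_forall_apply_zero (h2 : (2 : K) ≠ 0) (hβ0 : β ≠ 0)
    (hx : ∀ w ∈ W, scaledX β w ∈ W) (hy : ∀ w ∈ W, scaledY w ∈ W)
    (h0 : ∀ w ∈ W, w 0 = 0) : W = ⊥ := by
  have h2' : ∀ w ∈ W, w 2 = 0 := fun w hw => h0 _ (hy w hw)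
  have h1 : ∀ w ∈ W, w 1 = 0 := fun w hw => h2' _ (hy w hw)
  have h4 : ∀ w ∈ W, w 4 = 0 := fun w hw => h0 _ (hx w hw)
  have h6 : ∀ w ∈ W, w 6 = 0 := fun w hw => h4 _ (hy w hw)
  have h5 : ∀ w ∈ W, w 5 = 0 := fun w hw => h6 _ (hy w hw)
  have h3 : ∀ w ∈ W, w 3 = 0 := fun w hw => by
    have h : -w 1 + 2 * w 3 + w 5 = 0 := h5 _ (hx w hw)
    simpa [h1 w hw, h5 w hw, h2] using h
  have h7 : ∀ w ∈ W, w 7 = 0 := fun w hw => by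
    have h : -w 2 - β * w 6 - 2 * β * w 7 = 0 := h2' _ (hx w hw)
    simpa [h2' w hw, h6 w hw, h2, hβ0] using h
  rw [Submodule.eq_bot_iff]
  intro w hw
  ext i
  fin_cases i <;> simp [*]

theorem apply_zero_eq_zero_of_nortonRow (h2 : (2 : K) ≠ 0) (hβ1 : β ≠ 1)
    (hx : ∀ w ∈ W, scaledX β w ∈ W) (hy : ∀ w ∈ W, scaledY w ∈ W)
    (hrow : ∀ w ∈ W, nortonRow β ⬝ᵥ w = 0) : ∀ w ∈ W, w 0 = 0 := by
  intro w hw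
  have X {c₀ c₁ c₂ c₃ c₄ c₅ c₆ c₇ : K} (h : ![c₀, c₁, c₂, c₃, c₄, c₅, c₆, c₇] ∈ W) :
      ![c₄, c₁, -c₂ - β * c₆ - 2 * β * c₇, c₁ - c₃, c₀, -c₁ + 2 * c₃ + c₅, -c₆, c₆ + c₇] ∈ W :=
    hx _ h
  have Y {c₀ c₁ c₂ c₃ c₄ c₅ c₆ c₇ : K} (h : ![c₀, c₁, c₂, c₃, c₄, c₅, c₆, c₇] ∈ W) :
      ![c₂, c₀, c₁, c₃, c₆, c₄, c₅, c₇] ∈ W := hy _ h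
  have U {c₀ c₁ c₂ c₃ c₄ c₅ c₆ c₇ : K} (h : ![c₀, c₁, c₂, c₃, c₄, c₅, c₆, c₇] ∈ W) :
      -2 * c₁ + (β + 1) * c₂ - 2 * c₄ + (2 * β + 4) * c₅ + (2 * β + 6) * c₆ + 4 * c₇ = 0 := by
    have := hrow _ h
    simp [nortonRow, dotProduct, Fin.sum_univ_succ] at this
    linear_combination this
  rw [← vec_eight_eta w] at hw
  have key : 2 ^ 3 * (β - 1) ^ 2 * w 0 = 0 := by
    linear_combination
      (4 + 4 * β) * U (X hw)
      - 13 * U (Y hw)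
      - 11 * U (Y (X hw))
      + 6 * U (Y (X (Y hw)))
      + 18 * U (Y (Y (X hw)))
      + 4 * U (X (Y (X (Y hw))))
      + 4 * U (X (Y (Y (X hw))))
      + 4 * U (Y (X (Y (X hw))))
      - 12 * U (Y (X (Y (Y hw))))
      + (-20 - 4 * β) * U (Y (Y (X (Y hw))))
      - 8 * U (X (Y (Y (X (Y hw)))))
      - 4 * U (X (Y (X (Y (Y (X hw))))))
      - 2 * U (Y (X (Y (X (Y (Y hw))))))
      + 30 * U (Y (Y (X (Y (Y (X hw))))))
  simpa [h2, sub_ne_zero.mpr hβ1] using key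

theorem eq_bot_or_eq_top_of_scaled_invariant (h2 : (2 : K) ≠ 0) (hβ0 : β ≠ 0) (hβ1 : β ≠ 1)
    (hx : ∀ w ∈ W, scaledX β w ∈ W) (hy : ∀ w ∈ W, scaledY w ∈ W) : W = ⊥ ∨ W = ⊤ := by
  have hT : ∀ w ∈ W, (nortonMatrix β).mulVecLin w ∈ W := fun w hw => by
    rw [mulVecLin_apply, nortonMatrix_mulVec]
    exact W.add_mem (W.sub_mem (hx _ hw) (W.smul_mem _ (hy _ (hy _ (hx _ (hy _ (hy _ hw)))))))
      (hy _ (hx _ (hy _ (hy _ (hx _ hw)))))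
  obtain ⟨w, hw, hne, hker⟩ | hrow :=
    exists_mem_apply_eq_zero_or_forall_functional_eq_zero (nortonMatrix β).mulVecLin
      (dotProductBilin K K (nortonRow β)) nortonRow_dotProduct_nortonMatrix_mulVec W hT
  · right
    have hsmul := eq_smul_single_of_nortonMatrix_mulVec_eq_zero h2 hβ0 hβ1 w hker
    have hw1 : w 1 ≠ 0 := fun h => hne (by rw [hsmul, h, zero_smul])
    refine eq_top_of_single_mem hx hy ?_
    rw [hsmul] at hw
    exact (W.smul_mem_iff hw1).mp hw
  · left
    exact eq_bot_of_forall_apply_zero h2 hβ0 hx hy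
      (apply_zero_eq_zero_of_nortonRow h2 hβ1 hx hy hrow)

theorem eq_bot_or_eq_top_of_xMinusOdd_yMinusOdd_invariant {a ξ : K} (h2 : (2 : K) ≠ 0)
    (ha : a ≠ 0) (hξ : ξ ≠ 0) (h4 : a ^ 2 * ξ ≠ 2 ^ 2)
    (hx : ∀ w ∈ W, xMinusOdd K a ξ *ᵥ w ∈ W) (hy : ∀ w ∈ W, yMinusOdd K *ᵥ w ∈ W) :
    W = ⊥ ∨ W = ⊤ := by
  let e : Fin 8 → K := ![1, 1, 1, 1, 1 / 2, 1 / 2, 1 / 2, a / 2]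
  have he : ∀ i, e i ≠ 0 := by
    intro i
    fin_cases i <;> simp [e, h2, ha]
  let L : (Fin 8 → K) ≃ₗ[K] (Fin 8 → K) :=
    LinearEquiv.piCongrRight fun i => LinearEquiv.smulOfNeZero K K (e i) (he i)
  have hL : ∀ c i, L c i = e i * c i := fun _ _ => rfl
  have hLX : ∀ c, xMinusOdd K a ξ *ᵥ L c = L (scaledX (a ^ 2 * ξ / 2 ^ 2) c) := by
    intro c
    ext i
    fin_cases i <;>
      simp [xMinusOdd, scaledX, hL, e, mulVec, dotProduct, Fin.sum_univ_succ] <;>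
      field_simp <;> ring
  have hLY : ∀ c, yMinusOdd K *ᵥ L c = L (scaledY c) := by
    intro c
    ext i
    fin_cases i <;>
      simp [yMinusOdd, scaledY, hL, e, mulVec, dotProduct, Fin.sum_univ_succ]
  have h2sq : (2 : K) ^ 2 ≠ 0 := pow_ne_zero 2 h2
  have hscaled : W.comap L.toLinearMap = ⊥ ∨ W.comap L.toLinearMap = ⊤ := by
    refine eq_bot_or_eq_top_of_scaled_invariant (β := a ^ 2 * ξ / 2 ^ 2) h2
      (div_ne_zero (mul_ne_zero (pow_ne_zero 2 ha) hξ) h2sq)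
      (fun h => h4 ((div_eq_one_iff_eq h2sq).mp h)) ?_ ?_
    · intro c hc
      have := hx _ hc
      rwa [LinearEquiv.coe_coe, hLX] at this
    · intro c hc
      have := hy _ hc
      rwa [LinearEquiv.coe_coe, hLY] at this
  have hinj := Submodule.comap_injective_of_surjective (f := L.toLinearMap) L.surjective
  refine hscaled.imp (fun h => hinj ?_) (fun h => hinj ?_)
  · rw [h, Submodule.comap_bot, LinearEquiv.ker]
  · rw [h, Submodule.comap_top]

end ScaledAction

/-- For `q = p^f` odd, `ξ ∈ 𝔽_q*` a nonsquare and `a ∈ 𝔽_q*`, the group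
`⟨x(a,ξ), y⟩` is absolutely irreducible: the only subspaces of `K⁸` (`K` an
algebraic closure of `𝔽_q`) invariant under both `x(a,ξ)` and `y` are `{0}`
and `K⁸`. -/
theorem xMinusOdd_yMinusOdd_absolutely_irreducible
    (p f : ℕ) (hp : p.Prime) (hpodd : Odd p) (hf : 1 ≤ f)
    (F : Type*) [Field F] [Fintype F] (hcard : Fintype.card F = p ^ f)
    (ξ : F) (hξ0 : ξ ≠ 0) (hξ : ¬ ∃ t : F, t ^ 2 = ξ)
    (a : F) (ha0 : a ≠ 0)
    (K : Type*) [Field K] [Algebra F K] [IsAlgClosure F K]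
    (W : Submodule K (Fin 8 → K))
    (hxW : ∀ w ∈ W, (xMinusOdd K (algebraMap F K a) (algebraMap F K ξ)).mulVec w ∈ W)
    (hyW : ∀ w ∈ W, (yMinusOdd K).mulVec w ∈ W) :
    W = ⊥ ∨ W = ⊤ := by
  have h2 : (2 : F) ≠ 0 := by
    refine Ring.two_ne_zero fun h => ?_
    have heven := FiniteField.even_card_of_char_two h
    rw [hcard] at heven
    have hodd := Nat.odd_iff.mp (hpodd.pow (n := f))
    omega
  have hinj := (algebraMap F K).injective
  have hmap2 : algebraMap F K 2 = 2 := map_ofNat _ 2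
  refine eq_bot_or_eq_top_of_xMinusOdd_yMinusOdd_invariant
    (by simpa only [hmap2, map_zero] using hinj.ne h2) (by simpa using hinj.ne ha0) (by simpa using hinj.ne hξ0)
    (fun h => hξ ⟨2 / a, ?_⟩) hxW hyW
  have h' : a ^ 2 * ξ = 2 ^ 2 := hinj (by simpa [hmap2] using h)
  field_simp
  linear_combination -h'
end
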